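/- arXiv:2106.03557 — 6 statements merged into one kernel-verified Lean document; each statement's English description precedes it below -/
import Mathlib

section
/- Let A and B be two distinct circles in the Euclidean plane with centers C_A, C_B and radii r_A, r_B, such that A and B are not nested and, if they intersect, they intersect orthogonally. Then for every point p lying on the circle A, the circle B (as a set of points at distance r_B from C_B) meets the closed line segment from C_A to p in at most one point. -/
open scoped Classical

/-- A circle in the Euclidean plane, given by a center and a positive radius. -/
structure Circ where
  center : EuclideanSpace ℝ (Fin 2)
  radius : ℝ
  radius_pos : 0 < radius

namespace Circ

/-- The circle as a point set: points at distance exactly `radius` from the center. -/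
def points (C : Circ) : Set (EuclideanSpace ℝ (Fin 2)) := Metric.sphere C.center C.radius

/-- The closed disk bounded by the circle. -/
def closedDisk (C : Circ) : Set (EuclideanSpace ℝ (Fin 2)) := Metric.closedBall C.center C.radius

/-- The open disk bounded by the circle. -/
def openDisk (C : Circ) : Set (EuclideanSpace ℝ (Fin 2)) := Metric.ball C.center C.radius

/-- Two circles intersect if they share a point. -/
def Intersects (A B : Circ) : Prop := (A.points ∩ B.points).Nonempty

/-- Two circles intersect orthogonally. -/
def Orthogonal (A B : Circ) : Prop :=
  Intersects A B ∧ dist A.center B.center ^ 2 = A.radius ^ 2 + B.radius ^ 2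

/-- Two circles are nested if the closed disk bounded by one is contained in the
closed disk bounded by the other. -/
def Nested (A B : Circ) : Prop :=
  A.closedDisk ⊆ B.closedDisk ∨ B.closedDisk ⊆ A.closedDisk

end Circ

open Circ

/-- Number of unordered pairs of circles of `𝒜` that intersect. -/
noncomputable def edgeCount (𝒜 : Finset Circ) : ℕ :=
  ((𝒜.powersetCard 2).filter fun e => ∃ A ∈ e, ∃ B ∈ e, A ≠ B ∧ Intersects A B).card

/-- Two circles meet if the distance of their centers satisfies the triangle inequalities
together with the two radii. -/
theorem Circ.intersects_of_dist (A B : Circ) (hpos : 0 < dist A.center B.center)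
    (hA : A.radius ≤ dist A.center B.center + B.radius)
    (hB : B.radius ≤ dist A.center B.center + A.radius)
    (hle : dist A.center B.center ≤ A.radius + B.radius) : Intersects A B := by
  have hr := A.radius_pos
  set d := dist A.center B.center with hd
  have hw : ‖B.center - A.center‖ = d := by rw [← dist_eq_norm, dist_comm]
  have hmem : ∀ s : ℝ, |s| * d = A.radius →
      A.center + s • (B.center - A.center) ∈ Metric.sphere A.center A.radius := by
    intro s hs
    rw [mem_sphere_iff_norm, add_sub_cancel_left, norm_smul, hw, Real.norm_eq_abs, hs]
  have hdist : ∀ s : ℝ,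
      dist (A.center + s • (B.center - A.center)) B.center = |s - 1| * d := by
    intro s
    have h : A.center + s • (B.center - A.center) - B.center
        = (s - 1) • (B.center - A.center) := by module
    rw [dist_eq_norm, h, norm_smul, hw, Real.norm_eq_abs]
  have hdiv : A.radius / d * d = A.radius := div_mul_cancel₀ _ hpos.ne'
  have hq : 0 < A.radius / d := div_pos hr hpos
  have hrank : 1 < Module.rank ℝ (EuclideanSpace ℝ (Fin 2)) := by
    rw [← Module.finrank_eq_rank, finrank_euclideanSpace_fin]
    norm_num
  have hconn : IsPreconnected (Metric.sphere A.center A.radius) :=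
    isPreconnected_sphere hrank _ _
  have hcont : ContinuousOn (fun x => dist x B.center) (Metric.sphere A.center A.radius) := by
    fun_prop
  have hnear := hmem (A.radius / d) (by rw [abs_of_pos hq, hdiv])
  have hfar := hmem (-(A.radius / d)) (by rw [abs_neg, abs_of_pos hq, hdiv])
  obtain ⟨x, hx, hxB⟩ := hconn.intermediate_value hnear hfar hcont
    (show B.radius ∈ Set.Icc _ _ by
      simp only [hdist]
      constructor
      · rw [← abs_of_pos hpos, ← abs_mul, abs_of_pos hpos, sub_mul, hdiv, abs_le]
        constructor <;> linarith
      · rw [abs_of_neg (by linarith), neg_mul, sub_mul, neg_mul, hdiv]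
        linarith)
  exact ⟨x, hx, hxB⟩

theorem stmt1 (A B : Circ) (hAB : A ≠ B) (hnn : ¬ Nested A B)
    (horth : Intersects A B → Orthogonal A B) :
    ∀ p ∈ A.points, (B.points ∩ segment ℝ A.center p).Subsingleton := by
  intro p hp
  have hrA := A.radius_pos
  have hpn : ‖p - A.center‖ = A.radius := mem_sphere_iff_norm.1 hp
  rw [Nested, not_or] at hnn
  have h1 : B.radius < A.radius + dist A.center B.center := by
    by_contra! h
    exact hnn.1 (Metric.closedBall_subset_closedBall' h)
  have h2 : A.radius < B.radius + dist A.center B.center := by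
    by_contra! h
    exact hnn.2 (Metric.closedBall_subset_closedBall' (by rwa [dist_comm]))
  rintro x ⟨hxB, hx⟩ y ⟨hyB, hy⟩
  rw [segment_eq_image'] at hx hy
  obtain ⟨s, ⟨hs0, hs1⟩, rfl⟩ := hx
  obtain ⟨t, ⟨ht0, ht1⟩, rfl⟩ := hy
  by_cases hle : dist A.center B.center ≤ A.radius + B.radius
  · have hpos : 0 < dist A.center B.center := by
      rcases le_total A.radius B.radius with h | h <;> linarith
    have hd := (horth (A.intersects_of_dist B hpos (by linarith) (by linarith) hle)).2
    have key : ∀ u : ℝ, A.center + u • (p - A.center) ∈ B.points →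
        u ^ 2 * A.radius ^ 2 + 2 * u * inner ℝ (p - A.center) (A.center - B.center)
          + A.radius ^ 2 = 0 := by
      intro u hu
      have h : ‖u • (p - A.center) + (A.center - B.center)‖ = B.radius := by
        rw [← mem_sphere_iff_norm.1 hu]
        congr 1
        abel
      have h' := norm_add_sq_real (u • (p - A.center)) (A.center - B.center)
      rw [h, norm_smul, hpn, ← dist_eq_norm, hd, real_inner_smul_left, mul_pow,
        Real.norm_eq_abs, sq_abs] at h'
      linarith
    have ks := key s hxB
    have kt := key t hyB
    suffices s = t by rw [this]
    by_contra hne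
    have hprod : (s - t) * A.radius ^ 2 * (s * t - 1) = 0 := by
      linear_combination t * ks - s * kt
    have hst : s * t = 1 := by
      have := mul_ne_zero (sub_ne_zero.2 hne) (pow_ne_zero 2 hrA.ne')
      exact sub_eq_zero.1 ((mul_eq_zero.1 hprod).resolve_left this)
    exact hne (by nlinarith)
  · exfalso
    apply hle
    have hxA : dist A.center (A.center + s • (p - A.center)) ≤ A.radius := by
      rw [dist_self_add_right, norm_smul, hpn, Real.norm_eq_abs, abs_of_nonneg hs0]
      exact mul_le_of_le_one_left hrA.le hs1
    have hxB' : dist (A.center + s • (p - A.center)) B.center = B.radius := hxB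
    linarith [dist_triangle A.center (A.center + s • (p - A.center)) B.center]
end

section
/- Let A, B, D be three pairwise distinct circles in the Euclidean plane that are pairwise not nested and such that any two of them that intersect do so orthogonally. If A and B intersect, then the circle D (as a point set) is disjoint from the closed line segment joining the centers C_A and C_B of A and B. -/
open scoped Classical

open Circ

/-- Two circles in the plane whose radii and distance of centers satisfy the triangle inequalities
share a point. -/
lemma Circ.intersects_of_dist_le_add {A B : Circ}
    (hAB : A.radius < B.radius + dist A.center B.center)
    (hBA : B.radius < A.radius + dist A.center B.center)
    (hd : dist A.center B.center ≤ A.radius + B.radius) : Intersects A B := by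
  have ha := A.radius_pos
  have hb := B.radius_pos
  set a := A.radius with ha_def
  set b := B.radius with hb_def
  set d := dist A.center B.center with hd_def
  set x := B.center 0 - A.center 0 with hx
  set y := B.center 1 - A.center 1 with hy
  have hd0 : 0 < d := by
    rcases (dist_nonneg : 0 ≤ dist A.center B.center).lt_or_eq with h | h
    · exact h
    · rw [← hd_def] at h; linarith
  have hd2 : d ^ 2 = x ^ 2 + y ^ 2 := by
    rw [hd_def, EuclideanSpace.dist_sq_eq, Fin.sum_univ_two, Real.dist_eq, Real.dist_eq, sq_abs,
      sq_abs]
    ring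
  set s := (d ^ 2 + a ^ 2 - b ^ 2) / (2 * d ^ 2) with hs
  have hs' : 2 * d ^ 2 * s = d ^ 2 + a ^ 2 - b ^ 2 := by rw [hs]; field_simp
  have hnonneg : 0 ≤ a ^ 2 / d ^ 2 - s ^ 2 := by
    have h : a ^ 2 / d ^ 2 - s ^ 2 =
        ((a + d + b) * (a + d - b)) * ((b + d - a) * (b + a - d)) / (4 * d ^ 4) := by
      rw [hs]; field_simp; ring
    rw [h]
    refine div_nonneg (mul_nonneg (mul_nonneg ?_ ?_) (mul_nonneg ?_ ?_)) (by positivity) <;>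
      linarith
  set k := √(a ^ 2 / d ^ 2 - s ^ 2)
  have hk : d ^ 2 * k ^ 2 = a ^ 2 - d ^ 2 * s ^ 2 := by
    rw [Real.sq_sqrt hnonneg]; field_simp
  refine ⟨!₂[A.center 0 + s * x - k * y, A.center 1 + s * y + k * x], ?_, ?_⟩
  · rw [Circ.points, Metric.mem_sphere, ← sq_eq_sq₀ dist_nonneg ha.le, EuclideanSpace.dist_sq_eq,
      Fin.sum_univ_two, Real.dist_eq, Real.dist_eq, sq_abs, sq_abs]
    simp only [Matrix.cons_val_zero, Matrix.cons_val_one]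
    linear_combination hk - (s ^ 2 + k ^ 2) * hd2
  · rw [Circ.points, Metric.mem_sphere, ← sq_eq_sq₀ dist_nonneg hb.le, EuclideanSpace.dist_sq_eq,
      Fin.sum_univ_two, Real.dist_eq, Real.dist_eq, sq_abs, sq_abs]
    simp only [Matrix.cons_val_zero, Matrix.cons_val_one]
    rw [show B.center 0 = A.center 0 + x by rw [hx]; ring,
      show B.center 1 = A.center 1 + y by rw [hy]; ring]
    linear_combination hk - hs' - ((s - 1) ^ 2 + k ^ 2) * hd2

lemma Circ.radius_sq_add_radius_sq_le_dist_sq {A B : Circ} (hn : ¬ Nested A B)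
    (ho : Intersects A B → Orthogonal A B) :
    A.radius ^ 2 + B.radius ^ 2 ≤ dist A.center B.center ^ 2 := by
  by_cases hi : Intersects A B
  · exact (ho hi).2.ge
  · have ha := A.radius_pos
    have hb := B.radius_pos
    have hAB : B.radius < A.radius + dist A.center B.center := by
      by_contra! h
      exact hn (.inl (Metric.closedBall_subset_closedBall' h))
    have hBA : A.radius < B.radius + dist A.center B.center := by
      by_contra! h
      exact hn (.inr (Metric.closedBall_subset_closedBall' (by rwa [dist_comm])))
    have hd : A.radius + B.radius < dist A.center B.center := by
      by_contra! h
      exact hi (intersects_of_dist_le_add hBA hAB h)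
    nlinarith [mul_pos ha hb]

theorem stmt2 (A B D : Circ)
    (hAB : A ≠ B) (hAD : A ≠ D) (hBD : B ≠ D)
    (hnn : ({A, B, D} : Set Circ).Pairwise fun X Y => ¬ Nested X Y)
    (ho : ({A, B, D} : Set Circ).Pairwise fun X Y => Intersects X Y → Orthogonal X Y)
    (hint : Intersects A B) :
    Disjoint D.points (segment ℝ A.center B.center) := by
  have had := radius_sq_add_radius_sq_le_dist_sq (hnn (by simp) (by simp) hAD)
    (ho (by simp) (by simp) hAD)
  have hbd := radius_sq_add_radius_sq_le_dist_sq (hnn (by simp) (by simp) hBD)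
    (ho (by simp) (by simp) hBD)
  have hab := (ho (by simp) (by simp) hAB hint).2
  have ha := A.radius_pos
  have hb := B.radius_pos
  rw [Set.disjoint_left]
  rintro P hP ⟨s, t, hs, ht, hst, rfl⟩
  rw [Circ.points, Metric.mem_sphere] at hP
  have hP2 := congrArg (· ^ 2) hP
  simp only [EuclideanSpace.dist_sq_eq, Fin.sum_univ_two, Real.dist_eq, sq_abs, PiLp.add_apply,
    PiLp.smul_apply, smul_eq_mul] at hP2 had hbd hab
  obtain rfl : s = 1 - t := by linarith
  have hpos : 0 < ((1 - t) * A.radius) ^ 2 + (t * B.radius) ^ 2 := by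
    rcases ht.eq_or_lt with rfl | ht
    · simpa using pow_pos ha 2
    · positivity
  have had_s := mul_le_mul_of_nonneg_left had hs
  have hbd_t := mul_le_mul_of_nonneg_left hbd ht
  have hab_st := congrArg (t * (1 - t) * ·) hab
  nlinarith only [hpos, had_s, hbd_t, hab_st, hP2]
end

section
/- Let 𝒜 be a finite set of n ≥ 5 pairwise distinct circles in the Euclidean plane, pairwise not nested, such that any two circles of 𝒜 that intersect do so orthogonally. Then the number of unordered pairs of circles of 𝒜 that intersect is at most 3n − 8. -/
open scoped Classical

open Circ

namespace UpperEnvelope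

variable {ι : Type*}

/-- The value at `p` of the affine function with gradient `(a k, b k)` and offset `-w k`. -/
def value (a b w : ι → ℝ) (k : ι) (p : ℝ × ℝ) : ℝ := a k * p.1 + b k * p.2 - w k

/-- Positive when the point `(a k, b k)` lies to the left of the line from `(a i, b i)` to
`(a j, b j)`. -/
def orient (a b : ι → ℝ) (i j k : ι) : ℝ :=
  (a j - a i) * (b k - b i) - (a k - a i) * (b j - b i)

/-- The affine functions `i` and `j`, ordered by `a`, are jointly the only maximal ones at some
point. -/
def IsEdge (F : Finset ι) (a b w : ι → ℝ) (i j : ι) : Prop :=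
  i ∈ F ∧ j ∈ F ∧ a i < a j ∧
    ∃ p, value a b w i p = value a b w j p ∧
      ∀ k ∈ F, k ≠ i → k ≠ j → value a b w k p < value a b w i p

/-- `p` is the lower endpoint of the edge on which `i` and `j` are maximal. -/
def IsBottom (F : Finset ι) (a b w : ι → ℝ) (i j : ι) (p : ℝ × ℝ) : Prop :=
  value a b w i p = value a b w j p ∧ (∀ k ∈ F, value a b w k p ≤ value a b w i p) ∧
    ∀ k ∈ F, k ≠ i → k ≠ j → value a b w k p = value a b w i p → orient a b i j k < 0

/-- Every edge is charged to a slot of some function: slot `0` of its right function when that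
function has its lowest point (or no lowest point) at the bottom of the edge, slot `1` of its left
function when that one has its lowest point there, and otherwise slot `2` of a function whose
highest point is the bottom of the edge. -/
def Charges (F : Finset ι) (a b w : ι → ℝ) (i j : ι) (σ : ι × Fin 3) : Prop :=
  (σ = (j, 0) ∧ ∃ p, IsBottom F a b w i j p ∧
    ∃ k ∈ F, a j < a k ∧ value a b w k p = value a b w i p) ∨
  (σ = (j, 0) ∧ ∀ k ∈ F, 0 ≤ orient a b i j k) ∨
  (σ = (i, 1) ∧ ∃ p, IsBottom F a b w i j p ∧
    ∃ k ∈ F, a k < a i ∧ value a b w k p = value a b w i p) ∨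
  (∃ k ∈ F, σ = (k, 2) ∧ a i < a k ∧ a k < a j ∧ ∃ p, IsBottom F a b w i j p ∧
    value a b w k p = value a b w i p ∧
    ∀ m ∈ F, value a b w m p = value a b w i p → a i ≤ a m ∧ a m ≤ a j)

variable {F : Finset ι} {a b w : ι → ℝ}

lemma exists_isBottom {i j : ι} (h : IsEdge F a b w i j)
    (hk : ∃ k ∈ F, orient a b i j k < 0) :
    ∃ p, IsBottom F a b w i j p ∧
      ∃ k ∈ F, k ≠ i ∧ k ≠ j ∧ value a b w k p = value a b w i p := by
  obtain ⟨-, -, hij, q, hq, hlt⟩ := h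
  have hne : (F.filter fun k => orient a b i j k < 0).Nonempty := by
    obtain ⟨k, hkF, hk⟩ := hk
    exact ⟨k, by simp [hkF, hk]⟩
  obtain ⟨k, hkm, hmin⟩ := Finset.exists_min_image _
    (fun k => (value a b w i q - value a b w k q) / (-orient a b i j k)) hne
  simp only [Finset.mem_filter] at hkm hmin
  set s := (value a b w i q - value a b w k q) / (-orient a b i j k) with hs
  have hki : k ≠ i := by rintro rfl; simp [orient] at hkm
  have hkj : k ≠ j := by
    rintro rfl
    have : orient a b i k k = 0 := by unfold orient; ring
    linarith [hkm.2]
  have hs0 : 0 < s := div_pos (by linarith [hlt k hkm.1 hki hkj]) (by linarith [hkm.2])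
  have hp : ∀ m, value a b w i (q.1 + s * (b j - b i), q.2 - s * (a j - a i)) -
      value a b w m (q.1 + s * (b j - b i), q.2 - s * (a j - a i)) =
      value a b w i q - value a b w m q + s * orient a b i j m := by
    intro m; simp only [value, orient]; ring
  refine ⟨(q.1 + s * (b j - b i), q.2 - s * (a j - a i)), ⟨?_, ?_, ?_⟩, k, hkm.1, hki, hkj, ?_⟩
  · have := hp j
    have h0 : orient a b i j j = 0 := by unfold orient; ring
    rw [h0] at this
    linarith
  · intro m hm
    by_cases hmi : m = i
    · simp [hmi]
    by_cases hmj : m = j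
    · have := hp j
      have h0 : orient a b i j j = 0 := by unfold orient; ring
      rw [h0] at this
      subst hmj
      linarith
    have h1 := hp m
    have h2 := hlt m hm hmi hmj
    rcases le_or_gt 0 (orient a b i j m) with h3 | h3
    · nlinarith [mul_nonneg hs0.le h3]
    · have h4 := hmin m ⟨hm, h3⟩
      rw [le_div_iff₀ (by linarith)] at h4
      linarith
  · intro m hm hmi hmj he
    have h1 := hp m
    have h2 := hlt m hm hmi hmj
    by_contra h3
    push Not at h3
    nlinarith [mul_nonneg hs0.le h3]
  · have h1 := hp k
    have : s * (-orient a b i j k) = value a b w i q - value a b w k q :=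
      div_mul_cancel₀ _ (by linarith [hkm.2])
    linarith

lemma exists_charges (ha : Set.InjOn a F) {i j : ι} (h : IsEdge F a b w i j) :
    ∃ σ ∈ F ×ˢ (Finset.univ : Finset (Fin 3)), Charges F a b w i j σ := by
  by_cases hk : ∃ k ∈ F, orient a b i j k < 0
  · obtain ⟨p, hp, k, hkF, hki, hkj, hkp⟩ := exists_isBottom h hk
    by_cases h0 : ∃ k ∈ F, a j < a k ∧ value a b w k p = value a b w i p
    · exact ⟨(j, 0), by simp [h.2.1], .inl ⟨rfl, p, hp, h0⟩⟩
    by_cases h1 : ∃ k ∈ F, a k < a i ∧ value a b w k p = value a b w i p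
    · exact ⟨(i, 1), by simp [h.1], .inr (.inr (.inl ⟨rfl, p, hp, h1⟩))⟩
    push Not at h0 h1
    have hall : ∀ m ∈ F, value a b w m p = value a b w i p → a i ≤ a m ∧ a m ≤ a j := by
      intro m hm he
      exact ⟨not_lt.1 fun hlt => h1 m hm hlt he, not_lt.1 fun hlt => h0 m hm hlt he⟩
    have hik := (hall k hkF hkp).1.lt_of_ne fun he => hki (ha hkF h.1 he.symm)
    have hkj := (hall k hkF hkp).2.lt_of_ne fun he => hkj (ha hkF h.2.1 he)
    exact ⟨(k, 2), by simp [hkF], .inr (.inr (.inr ⟨k, hkF, rfl, hik, hkj, p, hp, hkp, hall⟩))⟩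
  · push Not at hk
    exact ⟨(j, 0), by simp [h.2.1], .inr (.inl ⟨rfl, hk⟩)⟩

/-- Where three functions agree and the middle one dominates above, it has its lowest point. -/
lemma lowest_unique {i j k : ι} {p q : ℝ × ℝ} (hij : a i < a j) (hjk : a j < a k)
    (ho : orient a b i j k < 0) (h1 : value a b w i p = value a b w j p)
    (h2 : value a b w k p = value a b w j p) (h3 : value a b w i q ≤ value a b w j q)
    (h4 : value a b w k q ≤ value a b w j q) : p.2 ≤ q.2 ∧ (p.2 = q.2 → p = q) := by
  have e3 : 0 ≤ (a j - a i) * (q.1 - p.1) + (b j - b i) * (q.2 - p.2) := by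
    simp only [value] at *; linarith
  have e4 : 0 ≤ (a j - a k) * (q.1 - p.1) + (b j - b k) * (q.2 - p.2) := by
    simp only [value] at *; linarith
  constructor
  · have e5 : 0 ≤ -orient a b i j k * (q.2 - p.2) := by
      have := add_nonneg (mul_nonneg (sub_nonneg.2 hjk.le) e3)
        (mul_nonneg (sub_nonneg.2 hij.le) e4)
      unfold orient
      linarith
    nlinarith
  · intro he
    rw [he, sub_self, mul_zero, add_zero] at e3 e4
    exact Prod.ext (by nlinarith) he

/-- Where three functions agree and the middle one is dominated above, it has its highest point. -/
lemma highest_unique {i j k : ι} {p q : ℝ × ℝ} (hij : a i < a j) (hjk : a j < a k)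
    (ho : 0 < orient a b i j k) (h1 : value a b w i p = value a b w j p)
    (h2 : value a b w k p = value a b w j p) (h3 : value a b w i q ≤ value a b w j q)
    (h4 : value a b w k q ≤ value a b w j q) : q.2 ≤ p.2 ∧ (p.2 = q.2 → p = q) := by
  have e : ∀ m x, value a (-b) w m (x.1, -x.2) = value a b w m x := by
    intro m x; simp [value]
  have := lowest_unique (a := a) (b := -b) (w := w) (p := (p.1, -p.2)) (q := (q.1, -q.2)) hij hjk
    (by simp only [orient, Pi.neg_apply] at *; linarith) (by simpa only [e] using h1)
    (by simpa only [e] using h2) (by simpa only [e] using h3) (by simpa only [e] using h4)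
  simp only [neg_le_neg_iff, neg_inj, Prod.mk.injEq] at this
  exact ⟨this.1, fun h => Prod.ext (this.2 h).1 h⟩

/-- For collinear gradients the excess of the middle function over the interpolation of the outer
two is constant. -/
lemma value_collinear {i j k : ι} (ho : orient a b i j k = 0) (p q : ℝ × ℝ) :
    (a j - a i) * value a b w k p - (a j - a k) * value a b w i p - (a k - a i) * value a b w j p =
    (a j - a i) * value a b w k q - (a j - a k) * value a b w i q
      - (a k - a i) * value a b w j q := by
  simp only [value, orient] at *
  linear_combination (p.2 - q.2) * ho

lemma orient_swap (i j k : ι) : orient a b k j i = -orient a b i j k := by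
  unfold orient; ring

lemma orient_rotate (i j k : ι) : orient a b k i j = orient a b i j k := by
  unfold orient; ring

lemma orient_comm (i j k : ι) : orient a b i k j = -orient a b i j k := by
  unfold orient; ring

/-- A point on a line with all of `k, m` above it does not lie above the segment `k m`. -/
lemma orient_nonneg_of_line {i j k l m : ι} (hij : a i < a j) (hl : l = i ∨ l = j)
    (hk : a k < a l) (hm : a l < a m)
    (h1 : 0 ≤ orient a b i j k) (h2 : 0 ≤ orient a b i j m) : 0 ≤ orient a b k l m := by
  have : (a j - a i) * orient a b k l m =
      (a l - a k) * orient a b i j m + (a m - a l) * orient a b i j k := by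
    rcases hl with rfl | rfl <;> (unfold orient; ring)
  have h3 : 0 ≤ (a j - a i) * orient a b k l m := by
    rw [this]
    exact add_nonneg (mul_nonneg (by linarith) h2) (mul_nonneg (by linarith) h1)
  exact nonneg_of_mul_nonneg_right h3 (by linarith)

lemma IsBottom.orient_neg {i j k : ι} {p : ℝ × ℝ} (h : IsBottom F a b w i j p) (hk : k ∈ F)
    (hi : a k ≠ a i) (hj : a k ≠ a j) (he : value a b w k p = value a b w i p) :
    orient a b i j k < 0 :=
  h.2.2 k hk (fun h => hi (h ▸ rfl)) (fun h => hj (h ▸ rfl)) he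

lemma charges_zero_iff {i j k : ι} : Charges F a b w i j (k, 0) ↔ k = j ∧
    ((∃ p, IsBottom F a b w i j p ∧ ∃ k ∈ F, a j < a k ∧ value a b w k p = value a b w i p) ∨
      ∀ k ∈ F, 0 ≤ orient a b i j k) := by
  simp [Charges, and_or_left]

lemma charges_one_iff {i j k : ι} : Charges F a b w i j (k, 1) ↔ k = i ∧
    ∃ p, IsBottom F a b w i j p ∧ ∃ k ∈ F, a k < a i ∧ value a b w k p = value a b w i p := by
  simp [Charges]

lemma charges_two_iff {i j k : ι} : Charges F a b w i j (k, 2) ↔ k ∈ F ∧ a i < a k ∧ a k < a j ∧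
    ∃ p, IsBottom F a b w i j p ∧ value a b w k p = value a b w i p ∧
      ∀ m ∈ F, value a b w m p = value a b w i p → a i ≤ a m ∧ a m ≤ a j := by
  simp only [Charges, Prod.mk.injEq, Fin.isValue, Fin.reduceEq, and_false, false_and, false_or,
    and_true]
  exact ⟨fun ⟨_, hk, he, h⟩ => he ▸ ⟨hk, h⟩, fun ⟨hk, h⟩ => ⟨k, hk, rfl, h⟩⟩

lemma charges_left_unique (ha : Set.InjOn a F) {i i' j : ι} (h : IsEdge F a b w i j)
    (h' : IsEdge F a b w i' j) (hc : Charges F a b w i j (j, 0))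
    (hc' : Charges F a b w i' j (j, 0)) : i = i' := by
  have key : ∀ {i i'}, IsEdge F a b w i j → IsEdge F a b w i' j →
      (∃ p, IsBottom F a b w i j p ∧ ∃ k ∈ F, a j < a k ∧ value a b w k p = value a b w i p) →
      (∀ k ∈ F, 0 ≤ orient a b i' j k) → False := by
    rintro i i' h h' ⟨p, hp, k, hk, hjk, he⟩ hl
    have h1 := hp.orient_neg hk (h.2.2.1.trans hjk).ne' hjk.ne' he
    have h2 := orient_nonneg_of_line h'.2.2.1 (.inr rfl) h.2.2.1 hjk (hl i h.1) (hl k hk)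
    linarith
  replace hc := (charges_zero_iff.1 hc).2
  replace hc' := (charges_zero_iff.1 hc').2
  rcases hc with hc | hc <;> rcases hc' with hc' | hc'
  · obtain ⟨p, hp, k, hk, hjk, he⟩ := hc
    obtain ⟨p', hp', k', hk', hjk', he'⟩ := hc'
    have h1 := hp.orient_neg hk (h.2.2.1.trans hjk).ne' hjk.ne' he
    have h1' := hp'.orient_neg hk' (h'.2.2.1.trans hjk').ne' hjk'.ne' he'
    have h2 := lowest_unique h.2.2.1 hjk h1 hp.1 (he.trans hp.1)
      (hp'.1 ▸ hp'.2.1 i h.1) (hp'.1 ▸ hp'.2.1 k hk)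
    have h2' := lowest_unique h'.2.2.1 hjk' h1' hp'.1 (he'.trans hp'.1)
      (hp.1 ▸ hp.2.1 i' h'.1) (hp.1 ▸ hp.2.1 k' hk')
    obtain rfl := h2.2 (le_antisymm h2.1 h2'.1)
    by_contra hne
    have h3 := hp.2.2 i' h'.1 (Ne.symm hne) (fun h => h'.2.2.1.ne (h ▸ rfl)) (hp'.1.trans hp.1.symm)
    have h4 := hp'.2.2 i h.1 hne (fun h' => h.2.2.1.ne (h' ▸ rfl)) (hp.1.trans hp'.1.symm)
    rw [orient_swap] at h4
    linarith
  · exact (key h h' hc hc').elim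
  · exact (key h' h hc' hc).elim
  · by_contra hne
    wlog hlt : a i < a i' generalizing i i'
    · exact this h' h hc' hc (Ne.symm hne)
        (lt_of_le_of_ne (not_lt.1 hlt) fun he => hne (ha h.1 h'.1 he.symm))
    have h0 : orient a b i j i' = 0 := by
      have h1 := hc i' h'.1
      have h2 := hc' i h.1
      rw [orient_swap] at h2
      linarith
    obtain ⟨hi, hj, hij, p, hp, hpk⟩ := h
    obtain ⟨hi', -, hij', q, hq, hqk⟩ := h'
    have h1 := value_collinear (w := w) h0 p q
    have h2 := hpk i' hi' (Ne.symm hne) (fun h => hij'.ne (h ▸ rfl))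
    have h3 := hqk i hi hne (fun h => hij.ne (h ▸ rfl))
    rw [← hp] at h1
    rw [← hq] at h1
    nlinarith [mul_pos (sub_pos.2 hij) (sub_pos.2 h2), mul_pos (sub_pos.2 hij') (sub_pos.2 h3)]

lemma charges_right_unique {i j j' : ι} (h : IsEdge F a b w i j)
    (h' : IsEdge F a b w i j') (hc : Charges F a b w i j (i, 1))
    (hc' : Charges F a b w i j' (i, 1)) : j = j' := by
  obtain ⟨-, p, hp, k, hk, hki, he⟩ := charges_one_iff.1 hc
  obtain ⟨-, p', hp', k', hk', hki', he'⟩ := charges_one_iff.1 hc'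
  have h1 := hp.orient_neg hk hki.ne (hki.trans h.2.2.1).ne he
  have h1' := hp'.orient_neg hk' hki'.ne (hki'.trans h'.2.2.1).ne he'
  have h2 := lowest_unique hki h.2.2.1 (by rwa [orient_rotate]) he hp.1.symm
    (hp'.2.1 k hk) (hp'.2.1 j h.2.1)
  have h2' := lowest_unique hki' h'.2.2.1 (by rwa [orient_rotate]) he' hp'.1.symm
    (hp.2.1 k' hk') (hp.2.1 j' h'.2.1)
  obtain rfl := h2.2 (le_antisymm h2.1 h2'.1)
  by_contra hne
  have h3 := hp.2.2 j' h'.2.1 (fun h => h'.2.2.1.ne (h ▸ rfl)) (Ne.symm hne) hp'.1.symm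
  have h4 := hp'.2.2 j h.2.1 (fun h' => h.2.2.1.ne (h' ▸ rfl)) hne hp.1.symm
  rw [orient_comm] at h4
  linarith

lemma charges_top_unique (ha : Set.InjOn a F) {i j i' j' k : ι} (h : IsEdge F a b w i j)
    (h' : IsEdge F a b w i' j') (hc : Charges F a b w i j (k, 2))
    (hc' : Charges F a b w i' j' (k, 2)) : i = i' ∧ j = j' := by
  obtain ⟨hk, hik, hkj, p, hp, he, hall⟩ := charges_two_iff.1 hc
  obtain ⟨-, hik', hkj', p', hp', he', hall'⟩ := charges_two_iff.1 hc'
  have h1 := hp.orient_neg hk hik.ne' hkj.ne he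
  have h1' := hp'.orient_neg hk hik'.ne' hkj'.ne he'
  have h2 := highest_unique hik hkj (by rw [orient_comm]; linarith)
    he.symm (hp.1.symm.trans he.symm) (he'.symm ▸ hp'.2.1 i h.1) (he'.symm ▸ hp'.2.1 j h.2.1)
  have h2' := highest_unique hik' hkj' (by rw [orient_comm]; linarith)
    he'.symm (hp'.1.symm.trans he'.symm) (he.symm ▸ hp.2.1 i' h'.1) (he.symm ▸ hp.2.1 j' h'.2.1)
  obtain rfl := h2.2 (le_antisymm h2'.1 h2.1)
  have hii : value a b w i p = value a b w i' p := he.symm.trans he'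
  exact ⟨ha h.1 h'.1 (le_antisymm (hall i' h'.1 hii.symm).1 (hall' i h.1 hii).1),
    ha h.2.1 h'.2.1 (le_antisymm (hall' j h.2.1 (hp.1.symm.trans hii)).2
      (hall j' h'.2.1 (hp'.1.symm.trans hii.symm)).2)⟩

lemma charges_unique (ha : Set.InjOn a F) {i j i' j' : ι} {σ : ι × Fin 3}
    (h : IsEdge F a b w i j) (h' : IsEdge F a b w i' j') (hc : Charges F a b w i j σ)
    (hc' : Charges F a b w i' j' σ) : (i, j) = (i', j') := by
  obtain ⟨k, c⟩ := σ
  fin_cases c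
  · obtain rfl := (charges_zero_iff.1 hc).1
    obtain rfl := (charges_zero_iff.1 hc').1
    rw [charges_left_unique ha h h' hc hc']
  · obtain rfl := (charges_one_iff.1 hc).1
    obtain rfl := (charges_one_iff.1 hc').1
    rw [charges_right_unique h h' hc hc']
  · obtain ⟨rfl, rfl⟩ := charges_top_unique ha h h' hc hc'
    rfl

/-- Slots that are charged by no edge lower the number of edges. -/
lemma card_edges_add_le (ha : Set.InjOn a F) (E : Finset (ι × ι)) (U : Finset (ι × Fin 3))
    (hE : ∀ e ∈ E, IsEdge F a b w e.1 e.2) (hUF : U ⊆ F ×ˢ Finset.univ)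
    (hU : ∀ e ∈ E, ∀ σ ∈ U, ¬ Charges F a b w e.1 e.2 σ) : E.card + U.card ≤ 3 * F.card := by
  choose f hfF hf using fun e : E => exists_charges ha (hE e e.2)
  have hinj : f.Injective := fun e e' hee =>
    Subtype.ext (charges_unique ha (hE e e.2) (hE e' e'.2) (hf e) (hee ▸ hf e'))
  have hdisj : Disjoint (Finset.univ.image f) U := by
    rw [Finset.disjoint_left]
    intro σ hσ hσU
    obtain ⟨e, -, rfl⟩ := Finset.mem_image.1 hσ
    exact hU e e.2 _ hσU (hf e)
  have hcard : (Finset.univ.image f).card = E.card := by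
    rw [Finset.card_image_of_injective _ hinj, Finset.card_univ, Fintype.card_coe]
  rw [← hcard, ← Finset.card_union_of_disjoint hdisj]
  refine (Finset.card_le_card (Finset.union_subset ?_ hUF)).trans ?_
  · exact Finset.image_subset_iff.2 fun e _ => hfF e
  · simp [mul_comm]

section LinearFunctional

variable {f : ι → ℝ} {α β : ℝ}

lemma mul_orient (hf : ∀ m, f m = α * a m + β * b m) (i j k : ι) :
    β * orient a b i j k = (a j - a k) * (f k - f i) + (a k - a i) * (f k - f j) := by
  simp only [orient, hf]; ring

lemma orient_nonneg_of_le (hβ : 0 < β) (hf : ∀ m, f m = α * a m + β * b m) {i j k : ι}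
    (hik : a i ≤ a k) (hkj : a k ≤ a j) (hi : f i ≤ f k) (hj : f j ≤ f k) :
    0 ≤ orient a b i j k := by
  refine nonneg_of_mul_nonneg_right ?_ hβ
  rw [mul_orient hf]
  exact add_nonneg (mul_nonneg (by linarith) (by linarith))
    (mul_nonneg (by linarith) (by linarith))

/-- A function that is somewhere the only maximal one has no gradient on an edge. -/
lemma IsEdge.orient_ne_zero {i j k : ι} (h : IsEdge F a b w i j) (hk : k ∈ F) (hik : a i < a k)
    (hkj : a k < a j) (hmax : ∃ q, ∀ m ∈ F, m ≠ k → value a b w m q < value a b w k q) :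
    orient a b i j k ≠ 0 := by
  intro h0
  obtain ⟨hi, hj, hij, p, hp, hlt⟩ := h
  obtain ⟨q, hq⟩ := hmax
  have hki : k ≠ i := fun h => hik.ne (h ▸ rfl)
  have hkj' : k ≠ j := fun h => hkj.ne (h ▸ rfl)
  have h1 := value_collinear (w := w) h0 p q
  rw [← hp] at h1
  have h2 := hlt k hk hki hkj'
  have h3 := hq i hi hki.symm
  have h4 := hq j hj hkj'.symm
  nlinarith [mul_pos (sub_pos.2 hij) (sub_pos.2 h2), mul_pos (sub_pos.2 hkj) (sub_pos.2 h3),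
    mul_pos (sub_pos.2 hik) (sub_pos.2 h4)]

lemma not_isEdge_of_le (hβ : 0 < β) (hf : ∀ m, f m = α * a m + β * b m) {i j k : ι}
    (hk : k ∈ F) (hik : a i < a k) (hkj : a k < a j)
    (hmax : ∃ q, ∀ m ∈ F, m ≠ k → value a b w m q < value a b w k q)
    (hij : f i = f j) (hki : f k ≤ f i) (ho : 0 ≤ orient a b i j k) : ¬ IsEdge F a b w i j := by
  intro h
  have h1 := mul_orient hf i j k
  rw [← hij] at h1
  have h2 : 0 < orient a b i j k := ho.lt_of_ne' (h.orient_ne_zero hk hik hkj hmax)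
  nlinarith [mul_pos hβ h2, h.2.2.1]

end LinearFunctional

end UpperEnvelope

section Quadrant

open UpperEnvelope

variable {ι : Type*} {F : Finset ι} {s t r : ι → ℝ}

lemma exists_injOn_sub_mul (hst : ∀ i ∈ F, ∀ j ∈ F, s i = s j → t i = t j → i = j) :
    ∃ μ : ℝ, 0 < μ ∧ Set.InjOn (fun k => s k - μ * t k) F := by
  obtain ⟨μ, hμ, hμF⟩ := (Set.Ioi_infinite (0 : ℝ)).exists_notMem_finset
    ((F ×ˢ F).image fun e => (s e.1 - s e.2) / (t e.1 - t e.2))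
  refine ⟨μ, hμ, fun i hi j hj he => ?_⟩
  simp only at he
  by_cases ht : t i = t j
  · exact hst i hi j hj (by rw [ht] at he; linarith) ht
  · refine (hμF (Finset.mem_image.2 ⟨(i, j), Finset.mem_product.2 ⟨hi, hj⟩, ?_⟩)).elim
    rw [div_eq_iff (sub_ne_zero.2 ht)]
    linarith

/-- Up to a common summand, minus the power of a point is an affine function of it. -/
lemma exists_value_eq_neg_power {μ : ℝ} (hμ : 0 < μ) (x y : ℝ) :
    ∃ p c, ∀ k, value (fun k => s k - μ * t k) (fun k => s k + t k)
      (fun k => s k ^ 2 + t k ^ 2 - r k ^ 2) k p =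
        c - ((x - s k) ^ 2 + (y - t k) ^ 2 - r k ^ 2) := by
  refine ⟨((2 * x - 2 * y) / (1 + μ), (2 * μ * x + 2 * y) / (1 + μ)), x ^ 2 + y ^ 2, fun k => ?_⟩
  have : 1 + μ ≠ 0 := by positivity
  simp only [value]
  field_simp
  ring

lemma exists_value_lt (hr : ∀ k ∈ F, 0 < r k)
    (hd : ∀ i ∈ F, ∀ j ∈ F, i ≠ j → r i ^ 2 + r j ^ 2 ≤ (s i - s j) ^ 2 + (t i - t j) ^ 2)
    {μ : ℝ} (hμ : 0 < μ) {k : ι} (hk : k ∈ F) :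
    ∃ q, ∀ m ∈ F, m ≠ k → value (fun k => s k - μ * t k) (fun k => s k + t k)
      (fun k => s k ^ 2 + t k ^ 2 - r k ^ 2) m q < value (fun k => s k - μ * t k)
      (fun k => s k + t k) (fun k => s k ^ 2 + t k ^ 2 - r k ^ 2) k q := by
  obtain ⟨q, c, hq⟩ := exists_value_eq_neg_power (s := s) (t := t) (r := r) hμ (s k) (t k)
  refine ⟨q, fun m hm hmk => ?_⟩
  rw [hq, hq]
  nlinarith [hd k hk m hm hmk.symm, pow_pos (hr k hk) 2]

lemma isEdge_of_orthogonal (hr : ∀ k ∈ F, 0 < r k)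
    (hd : ∀ i ∈ F, ∀ j ∈ F, i ≠ j → r i ^ 2 + r j ^ 2 ≤ (s i - s j) ^ 2 + (t i - t j) ^ 2)
    {μ : ℝ} (hμ : 0 < μ) {i j : ι} (hi : i ∈ F) (hj : j ∈ F)
    (he : (s i - s j) ^ 2 + (t i - t j) ^ 2 = r i ^ 2 + r j ^ 2)
    (ha : s i - μ * t i < s j - μ * t j) :
    IsEdge F (fun k => s k - μ * t k) (fun k => s k + t k)
      (fun k => s k ^ 2 + t k ^ 2 - r k ^ 2) i j := by
  have hri := pow_pos (hr i hi) 2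
  have hrj := pow_pos (hr j hj) 2
  set D := r i ^ 2 + r j ^ 2 with hD
  have hD0 : 0 < D := by positivity
  set x := (r j ^ 2 * s i + r i ^ 2 * s j) / D with hx
  set y := (r j ^ 2 * t i + r i ^ 2 * t j) / D with hy
  have hpow : ∀ k, D * ((x - s k) ^ 2 + (y - t k) ^ 2 - r k ^ 2) =
      r j ^ 2 * ((s i - s k) ^ 2 + (t i - t k) ^ 2 - r k ^ 2) +
      r i ^ 2 * ((s k - s j) ^ 2 + (t k - t j) ^ 2 - r k ^ 2) - r i ^ 2 * r j ^ 2 := by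
    intro k
    have hx' : D * x = r j ^ 2 * s i + r i ^ 2 * s j := by rw [hx]; field_simp
    have hy' : D * y = r j ^ 2 * t i + r i ^ 2 * t j := by rw [hy]; field_simp
    have key : D * (D * ((x - s k) ^ 2 + (y - t k) ^ 2 - r k ^ 2)) =
        D * (r j ^ 2 * ((s i - s k) ^ 2 + (t i - t k) ^ 2 - r k ^ 2) +
        r i ^ 2 * ((s k - s j) ^ 2 + (t k - t j) ^ 2 - r k ^ 2) - r i ^ 2 * r j ^ 2) := by
      have : D * (D * ((x - s k) ^ 2 + (y - t k) ^ 2 - r k ^ 2)) =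
          (D * x - D * s k) ^ 2 + (D * y - D * t k) ^ 2 - D ^ 2 * r k ^ 2 := by ring
      rw [this, hx', hy']
      have h2 : (r i ^ 2 * r j ^ 2) * ((s i - s j) ^ 2 + (t i - t j) ^ 2 - D) = 0 := by
        rw [he]; ring
      rw [hD] at h2 ⊢
      linear_combination (-1 : ℝ) * h2
    exact mul_left_cancel₀ hD0.ne' key
  obtain ⟨p, c, hp⟩ := exists_value_eq_neg_power (s := s) (t := t) (r := r) hμ x y
  have hpi := hpow i
  have hpj := hpow j
  rw [he] at hpi hpj
  refine ⟨hi, hj, ha, p, ?_, fun k hk hki hkj => ?_⟩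
  · rw [hp, hp]
    have : D * ((x - s i) ^ 2 + (y - t i) ^ 2 - r i ^ 2) =
        D * ((x - s j) ^ 2 + (y - t j) ^ 2 - r j ^ 2) := by rw [hpi, hpj, hD]; ring
    linarith [mul_left_cancel₀ hD0.ne' this]
  · rw [hp, hp]
    have hpk := hpow k
    have h1 := hd i hi k hk hki.symm
    have h2 := hd k hk j hj hkj
    have : D * ((x - s i) ^ 2 + (y - t i) ^ 2 - r i ^ 2) <
        D * ((x - s k) ^ 2 + (y - t k) ^ 2 - r k ^ 2) := by
      rw [hpi, hpk, hD]
      nlinarith [mul_nonneg hrj.le (sub_nonneg.2 h1), mul_nonneg hri.le (sub_nonneg.2 h2),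
        mul_pos hri hrj]
    linarith [lt_of_mul_lt_mul_left this hD0.le]

/-- Orthogonal or disjoint circles in a quadrant, each of which is orthogonal to or disjoint from
each of the two boundary lines, have few orthogonal pairs, even when counting the lines. -/
lemma card_orthogonal_in_quadrant (hr : ∀ k ∈ F, 0 < r k)
    (hd : ∀ i ∈ F, ∀ j ∈ F, i ≠ j → r i ^ 2 + r j ^ 2 ≤ (s i - s j) ^ 2 + (t i - t j) ^ 2)
    (hF : 3 ≤ F.card) {s₀ t₀ : ℝ}
    (hs : ∀ k ∈ F, s k = s₀ ∨ s k + r k < s₀) (ht : ∀ k ∈ F, t k = t₀ ∨ t k + r k < t₀) :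
    ∃ E : Finset (ι × ι), (∀ i ∈ F, ∀ j ∈ F, i ≠ j →
        (s i - s j) ^ 2 + (t i - t j) ^ 2 = r i ^ 2 + r j ^ 2 → (i, j) ∈ E ∨ (j, i) ∈ E) ∧
      E.card + (F.filter (s · = s₀)).card + (F.filter (t · = t₀)).card + 3 ≤ 3 * F.card := by
  have hst : ∀ i ∈ F, ∀ j ∈ F, s i = s j → t i = t j → i = j := by
    intro i hi j hj h1 h2
    by_contra hij
    have := hd i hi j hj hij
    rw [h1, h2] at this
    nlinarith [pow_pos (hr i hi) 2, pow_pos (hr j hj) 2]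
  obtain ⟨μ, hμ, ha⟩ := exists_injOn_sub_mul hst
  have hmax := fun k (hk : k ∈ F) => exists_value_lt hr hd hμ hk
  have hedge := fun i j (hi : i ∈ F) (hj : j ∈ F) => isEdge_of_orthogonal hr hd hμ hi hj
  have hsle : ∀ k ∈ F, s k ≤ s₀ := fun k hk => (hs k hk).elim le_of_eq fun h => by
    linarith [hr k hk]
  have htle : ∀ k ∈ F, t k ≤ t₀ := fun k hk => (ht k hk).elim le_of_eq fun h => by
    linarith [hr k hk]
  set a := fun k => s k - μ * t k with ha_def
  set b := fun k => s k + t k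
  set w := fun k => s k ^ 2 + t k ^ 2 - r k ^ 2
  have hsf : ∀ m, s m = (1 / (1 + μ)) * a m + (μ / (1 + μ)) * b m := by
    intro m; simp only [a, b]; field_simp; ring
  have htf : ∀ m, t m = (-1 / (1 + μ)) * a m + (1 / (1 + μ)) * b m := by
    intro m; simp only [a, b]; field_simp; ring
  have hβs : 0 < μ / (1 + μ) := by positivity
  have hβt : 0 < 1 / (1 + μ) := by positivity
  have hFne : F.Nonempty := Finset.card_pos.1 (by omega)
  obtain ⟨L, hL, hLmin⟩ := Finset.exists_min_image F a hFne
  obtain ⟨R, hR, hRmax⟩ := Finset.exists_max_image F a hFne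
  obtain ⟨M, hM, hML, hMR⟩ : ∃ M ∈ F, M ≠ L ∧ M ≠ R := by
    by_contra! h
    have : F ⊆ {L, R} := fun m hm => by
      by_cases hmL : m = L
      · simp [hmL]
      · simp [h m hm hmL]
    have := (Finset.card_le_card this).trans Finset.card_le_two
    omega
  have hLM : a L < a M := (hLmin M hM).lt_of_ne fun h => hML (ha hM hL h.symm)
  have hMR' : a M < a R := (hRmax M hM).lt_of_ne fun h => hMR (ha hM hR h)
  have hLR : L ≠ R := fun h => (hLM.trans hMR').ne (h ▸ rfl)
  set E := (F ×ˢ F).filter fun e => a e.1 < a e.2 ∧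
    (s e.1 - s e.2) ^ 2 + (t e.1 - t e.2) ^ 2 = r e.1 ^ 2 + r e.2 ^ 2 with hE_def
  have hE : ∀ e ∈ E, IsEdge F a b w e.1 e.2 := by
    rintro ⟨i, j⟩ he
    simp only [hE_def, Finset.mem_filter, Finset.mem_product] at he
    exact hedge i j he.1.1 he.1.2 he.2.2 he.2.1
  refine ⟨E, ?_, ?_⟩
  · intro i hi j hj hij he
    simp only [hE_def, Finset.mem_filter, Finset.mem_product, hi, hj, true_and, he, and_true]
    rcases lt_trichotomy (a i) (a j) with h | h | h
    · exact .inl h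
    · exact (hij (ha hi hj h)).elim
    · exact .inr ⟨h, by rw [add_comm (r j ^ 2), ← he]; ring⟩
  set S := F.filter (s · = s₀)
  set T := F.filter (t · = t₀)
  have hmemS : ∀ {k}, k ∈ S ↔ k ∈ F ∧ s k = s₀ := by simp [S]
  have hmemT : ∀ {k}, k ∈ T ↔ k ∈ F ∧ t k = t₀ := by simp [T]
  set W := insert L (insert R (S ∪ T)) with hW
  set U : Finset (ι × Fin 3) := {(L, 0), (L, 1), (R, 1)} ∪ W.image fun k => (k, 2)
  have hWF : W ⊆ F := by
    intro k hk
    simp only [W, Finset.mem_insert, Finset.mem_union, hmemS, hmemT] at hk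
    rcases hk with rfl | rfl | hk | hk
    exacts [hL, hR, hk.1, hk.1]
  have hUF : U ⊆ F ×ˢ Finset.univ := by
    intro σ hσ
    simp only [U, Finset.mem_union, Finset.mem_insert, Finset.mem_singleton,
      Finset.mem_image] at hσ
    rcases hσ with (rfl | rfl | rfl) | ⟨k, hk, rfl⟩
    · simp [hL]
    · simp [hL]
    · simp [hR]
    · simp [hWF hk]
  have hUcard : U.card = 3 + W.card := by
    rw [Finset.card_union_of_disjoint, Finset.card_image_of_injective]
    · congr 1
      rw [Finset.card_eq_three]
      exact ⟨_, _, _, by simp, by simp, by simp [hLR], rfl⟩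
    · exact fun _ _ h => (Prod.mk.inj h).1
    · rw [Finset.disjoint_left]
      rintro σ hσ hσ'
      obtain ⟨k, -, rfl⟩ := Finset.mem_image.1 hσ'
      simp at hσ
  have hU : ∀ e ∈ E, ∀ σ ∈ U, ¬ Charges F a b w e.1 e.2 σ := by
    rintro ⟨i, j⟩ he σ hσ hc
    have hij := hE _ he
    simp only [U, Finset.mem_union, Finset.mem_insert, Finset.mem_singleton,
      Finset.mem_image] at hσ
    rcases hσ with (rfl | rfl | rfl) | ⟨k, hk, rfl⟩
    · obtain ⟨rfl, -⟩ := charges_zero_iff.1 hc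
      exact (hLmin i hij.1).not_gt hij.2.2.1
    · obtain ⟨rfl, -, -, k, hk, hki, -⟩ := charges_one_iff.1 hc
      exact (hLmin k hk).not_gt hki
    · obtain ⟨rfl, -⟩ := charges_one_iff.1 hc
      exact (hRmax j hij.2.1).not_gt hij.2.2.1
    · obtain ⟨hkF, hik, hkj, p, hp, hpk, -⟩ := charges_two_iff.1 hc
      have ho := hp.orient_neg hkF hik.ne' hkj.ne hpk
      simp only [W, Finset.mem_insert, Finset.mem_union, hmemS, hmemT] at hk
      rcases hk with rfl | rfl | hk | hk
      · exact (hLmin i hij.1).not_gt hik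
      · exact (hRmax j hij.2.1).not_gt hkj
      · exact ho.not_ge (orient_nonneg_of_le hβs hsf hik.le hkj.le
          (hk.2 ▸ hsle i hij.1) (hk.2 ▸ hsle j hij.2.1))
      · exact ho.not_ge (orient_nonneg_of_le hβt htf hik.le hkj.le
          (hk.2 ▸ htle i hij.1) (hk.2 ▸ htle j hij.2.1))
  have hbase := card_edges_add_le ha E U hE hUF hU
  have hST := Finset.card_union_add_card_inter S T
  have hinter : (S ∩ T).card ≤ 1 := Finset.card_le_one.2 fun i hi j hj => by
    simp only [Finset.mem_inter, hmemS, hmemT] at hi hj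
    exact hst i hi.1.1 j hj.1.1 (hi.1.2.trans hj.1.2.symm) (hi.2.2.trans hj.2.2.symm)
  have hSTW : (S ∪ T).card ≤ W.card := Finset.card_le_card fun k hk => by simp [W, hk]
  by_cases hdone : S.card + T.card ≤ W.card
  · omega
  obtain ⟨C, hC⟩ : (S ∩ T).Nonempty := Finset.card_pos.1 (by omega)
  have hWsub : W ⊆ S ∪ T := by
    by_contra hsub
    have : (S ∪ T).card < W.card := Finset.card_lt_card
      ⟨fun k hk => by simp [W, hk], hsub⟩
    omega
  have hLW : L ∈ S ∪ T := hWsub (by simp [W])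
  have hRW : R ∈ S ∪ T := hWsub (by simp [W])
  simp only [Finset.mem_inter, Finset.mem_union, hmemS, hmemT, hL, hR, true_and] at hC hLW hRW
  obtain ⟨⟨hCF, hCs⟩, -, hCt⟩ := hC
  have hLT : t L = t₀ := by
    refine hLW.elim (fun h => le_antisymm (htle L hL) ?_) id
    have := hLmin C hCF
    simp only [a, h, hCs, hCt] at this
    nlinarith
  have hRS : s R = s₀ := by
    refine hRW.elim id fun h => le_antisymm (hsle R hR) ?_
    have := hRmax C hCF
    simp only [a, h, hCs, hCt] at this
    linarith
  have hLR' : (L, R) ∈ E → ¬ ∀ k ∈ F, 0 ≤ orient a b L R k := by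
    intro he hl
    rcases hs L hL with hLs | hLs
    · exact not_isEdge_of_le hβs hsf hM hLM hMR' (hmax M hM) (hLs.trans hRS.symm)
        (hLs ▸ hsle M hM) (hl M hM) (hE _ he)
    rcases ht R hR with hRt | hRt
    · exact not_isEdge_of_le hβt htf hM hLM hMR' (hmax M hM) (hLT.trans hRt.symm)
        (hLT ▸ htle M hM) (hl M hM) (hE _ he)
    simp only [hE_def, Finset.mem_filter] at he
    rw [hRS, hLT] at he
    nlinarith [he.2.2, hr L hL, hr R hR]
  suffices h : ∃ σ ∈ F ×ˢ Finset.univ, σ ∉ U ∧ ∀ e ∈ E, ¬ Charges F a b w e.1 e.2 σ by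
    obtain ⟨σ, hσF, hσU, hσ⟩ := h
    have := card_edges_add_le ha E (insert σ U) hE (Finset.insert_subset hσF hUF)
      fun e he τ hτ => (Finset.mem_insert.1 hτ).elim (fun h => h ▸ hσ e he) (hU e he τ)
    rw [Finset.card_insert_of_notMem hσU] at this
    omega
  by_cases h : ∃ i, (i, R) ∈ E ∧ ∀ k ∈ F, 0 ≤ orient a b i R k
  · obtain ⟨i, he, hl⟩ := h
    have hiR := hE _ he
    have hiL : i ≠ L := by rintro rfl; exact hLR' he hl
    have hiR' : i ≠ R := fun h => hiR.2.2.1.ne (h ▸ rfl)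
    refine ⟨(i, 1), by simp [hiR.1], by simp [U, hiL, hiR'], ?_⟩
    rintro ⟨i', j⟩ he' hc
    obtain ⟨rfl, p, hp, k, hk, hki, hpk⟩ := charges_one_iff.1 hc
    have hij := hE _ he'
    have ho := hp.orient_neg hk hki.ne (hki.trans hij.2.2.1).ne hpk
    have := orient_nonneg_of_line hiR.2.2.1 (.inl rfl) hki hij.2.2.1 (hl k hk) (hl j hij.2.1)
    rw [orient_rotate] at this
    exact ho.not_ge this
  · refine ⟨(R, 0), by simp [hR], by simp [U, hLR.symm], ?_⟩
    rintro ⟨i, j⟩ he hc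
    obtain ⟨rfl, ⟨p, hp, k, hk, hRk, -⟩ | hl⟩ := charges_zero_iff.1 hc
    · exact (hRmax k hk).not_gt hRk
    · exact h ⟨i, he, hl⟩

end Quadrant

lemma sq_add_sq_sub_le {u₁ u₂ w₁ w₂ a b : ℝ} (ha : 0 ≤ a) (hb : 0 ≤ b)
    (hu : u₁ ^ 2 + u₂ ^ 2 ≤ a ^ 2) (hw : w₁ ^ 2 + w₂ ^ 2 ≤ b ^ 2) :
    (u₁ - w₁) ^ 2 + (u₂ - w₂) ^ 2 ≤ (a + b) ^ 2 := by
  have h : (u₁ * w₁ + u₂ * w₂) ^ 2 ≤ (a * b) ^ 2 := by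
    calc (u₁ * w₁ + u₂ * w₂) ^ 2 ≤ (u₁ ^ 2 + u₂ ^ 2) * (w₁ ^ 2 + w₂ ^ 2) := by
          nlinarith [sq_nonneg (u₁ * w₂ - u₂ * w₁)]
      _ ≤ a ^ 2 * b ^ 2 := by gcongr
      _ = (a * b) ^ 2 := by ring
  have := (abs_le_of_sq_le_sq' h (by positivity)).1
  nlinarith

lemma height_lt_of_inner_gt {r s z₁ z₂ v₁ v₂ : ℝ} (hr : 0 < r) (hs : 0 < s)
    (hz : z₁ ^ 2 + z₂ ^ 2 = r ^ 2) (hv : v₁ ^ 2 + v₂ ^ 2 = r ^ 2 + s ^ 2) (hvr : v₂ < r)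
    (h : r ^ 2 < z₁ * v₁ + z₂ * v₂) :
    z₂ < (r ^ 2 * v₂ + r * s * |v₁|) / (r ^ 2 + s ^ 2) := by
  have hz₂ : z₂ < r := by
    have hle : z₂ ≤ r := (abs_le_of_sq_le_sq' (by nlinarith [sq_nonneg z₁]) hr.le).2
    refine hle.lt_of_ne fun he => ?_
    have : z₁ = 0 := by
      rw [he] at hz
      exact pow_eq_zero_iff two_ne_zero |>.1 (by linarith)
    rw [this, he] at h
    nlinarith
  have hrv : r * v₂ < r ^ 2 := by nlinarith
  have hden : 0 < z₁ * v₁ + z₂ * v₂ - r * v₂ := by linarith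
  set θ := (r ^ 2 - r * v₂) / (z₁ * v₁ + z₂ * v₂ - r * v₂) with hθ
  have hθ0 : 0 < θ := div_pos (by linarith) hden
  have hθ1 : θ < 1 := (div_lt_one hden).2 (by linarith)
  have hθm : θ * (z₁ * v₁ + z₂ * v₂ - r * v₂) = r ^ 2 - r * v₂ := div_mul_cancel₀ _ hden.ne'
  set m₁ := θ * z₁ with hm₁
  set m₂ := (1 - θ) * r + θ * z₂ with hm₂
  have hinner : m₁ * v₁ + m₂ * v₂ = r ^ 2 := by
    rw [hm₁, hm₂]; linear_combination hθm
  have hnorm : m₁ ^ 2 + m₂ ^ 2 ≤ r ^ 2 := by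
    have : m₁ ^ 2 + m₂ ^ 2 = r ^ 2 - 2 * (θ * (1 - θ) * (r * (r - z₂))) := by
      rw [hm₁, hm₂]; linear_combination θ ^ 2 * hz
    have : 0 ≤ θ * (1 - θ) * (r * (r - z₂)) :=
      mul_nonneg (mul_nonneg hθ0.le (by linarith)) (mul_nonneg hr.le (by linarith))
    linarith
  have hcross : (m₂ * v₁ - m₁ * v₂) ^ 2 ≤ (r * s) ^ 2 := by
    have h1 : (m₂ * v₁ - m₁ * v₂) ^ 2 =
        (m₁ ^ 2 + m₂ ^ 2) * (r ^ 2 + s ^ 2) - (r ^ 2) ^ 2 := by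
      rw [← hv, ← hinner]; ring
    have h2 := mul_le_mul_of_nonneg_right hnorm (by positivity : 0 ≤ r ^ 2 + s ^ 2)
    rw [h1]; linarith
  have hcabs := abs_le_of_sq_le_sq hcross (by positivity)
  have hz₂m : z₂ < m₂ := by
    have : 0 < (1 - θ) * (r - z₂) := mul_pos (by linarith) (by linarith)
    rw [hm₂]; linarith
  refine hz₂m.trans_le ((le_div_iff₀ (by positivity)).2 ?_)
  have h3 : m₂ * (r ^ 2 + s ^ 2) = r ^ 2 * v₂ + (m₂ * v₁ - m₁ * v₂) * v₁ := by
    rw [← hv, ← hinner]; ring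
  have h4 : (m₂ * v₁ - m₁ * v₂) * v₁ ≤ r * s * |v₁| :=
    (le_abs_self _).trans (by rw [abs_mul]; gcongr)
  linarith

lemma exists_corner {r s v₁ v₂ : ℝ} (hr : 0 < r) (hs : 0 < s)
    (hv : v₁ ^ 2 + v₂ ^ 2 = r ^ 2 + s ^ 2) :
    ∃ z₁, ∀ z₂, z₂ = (r ^ 2 * v₂ + r * s * |v₁|) / (r ^ 2 + s ^ 2) →
      z₁ ^ 2 + z₂ ^ 2 = r ^ 2 ∧ z₁ * v₁ + z₂ * v₂ = r ^ 2 := by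
  obtain ⟨σ, hσ, hσv⟩ : ∃ σ : ℝ, σ ^ 2 = 1 ∧ |v₁| = σ * v₁ := by
    rcases abs_choice v₁ with h | h
    · exact ⟨1, by norm_num, by rw [h]; ring⟩
    · exact ⟨-1, by norm_num, by rw [h]; ring⟩
  have hV : r ^ 2 + s ^ 2 ≠ 0 := by positivity
  refine ⟨(r ^ 2 * v₁ - r * s * σ * v₂) / (r ^ 2 + s ^ 2), ?_⟩
  rintro z₂ rfl
  rw [hσv]
  constructor
  · field_simp
    linear_combination (r ^ 2 + s ^ 2 * σ ^ 2) * hv + s ^ 2 * (r ^ 2 + s ^ 2) * hσ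
  · field_simp
    linear_combination r * hv

lemma not_three_orthogonal {a₁ a₂ b₁ b₂ c₁ c₂ : ℝ} (ha : 0 < a₁ ^ 2 + a₂ ^ 2)
    (hb : 0 < b₁ ^ 2 + b₂ ^ 2) (hc : 0 < c₁ ^ 2 + c₂ ^ 2) (hab : a₁ * b₁ + a₂ * b₂ = 0)
    (hac : a₁ * c₁ + a₂ * c₂ = 0) (hbc : b₁ * c₁ + b₂ * c₂ = 0) : False := by
  have hdet : b₁ * c₂ - b₂ * c₁ = 0 := by
    have h1 : (a₁ ^ 2 + a₂ ^ 2) * (b₁ * c₂ - b₂ * c₁) = 0 := by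
      linear_combination (a₁ * c₂ - a₂ * c₁) * hab + (-a₁ * b₂ + a₂ * b₁) * hac
    exact (mul_eq_zero.1 h1).resolve_left ha.ne'
  have : (b₁ ^ 2 + b₂ ^ 2) * (c₁ ^ 2 + c₂ ^ 2) = 0 := by
    linear_combination (b₁ * c₁ + b₂ * c₂) * hbc + (b₁ * c₂ - b₂ * c₁) * hdet
  exact (mul_pos hb hc).ne' this

section Corner

variable {ι : Type*} {G : Finset ι} {x y r : ι → ℝ}

/-- Among orthogonal or disjoint circles, some two orthogonal ones meet in a point that lies
strictly outside all the others. -/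
lemma exists_uncovered_corner (hr : ∀ k ∈ G, 0 < r k)
    (hd : ∀ i ∈ G, ∀ j ∈ G, i ≠ j → (x i - x j) ^ 2 + (y i - y j) ^ 2 = r i ^ 2 + r j ^ 2 ∨
      (r i + r j) ^ 2 < (x i - x j) ^ 2 + (y i - y j) ^ 2)
    (hne : ∃ i ∈ G, ∃ j ∈ G, i ≠ j ∧ (x i - x j) ^ 2 + (y i - y j) ^ 2 = r i ^ 2 + r j ^ 2) :
    ∃ A ∈ G, ∃ B ∈ G, A ≠ B ∧ (x A - x B) ^ 2 + (y A - y B) ^ 2 = r A ^ 2 + r B ^ 2 ∧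
      ∃ p q : ℝ, (x A - p) ^ 2 + (y A - q) ^ 2 = r A ^ 2 ∧
        (x B - p) ^ 2 + (y B - q) ^ 2 = r B ^ 2 ∧
        ∀ k ∈ G, k ≠ A → k ≠ B → r k ^ 2 < (x k - p) ^ 2 + (y k - q) ^ 2 := by
  let N : ι → Finset ι := fun i =>
    G.filter fun j => i ≠ j ∧ (x i - x j) ^ 2 + (y i - y j) ^ 2 = r i ^ 2 + r j ^ 2
  have hN : ∀ i j, j ∈ N i ↔
      j ∈ G ∧ i ≠ j ∧ (x i - x j) ^ 2 + (y i - y j) ^ 2 = r i ^ 2 + r j ^ 2 := fun i j => by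
    simp [N]
  obtain ⟨A, hAG, hAmax⟩ := Finset.exists_max_image (G.filter fun i => (N i).Nonempty)
    (fun i => y i + r i) (by
      obtain ⟨i, hi, j, hj, hij, h⟩ := hne
      exact ⟨i, Finset.mem_filter.2 ⟨hi, j, (hN i j).2 ⟨hj, hij, h⟩⟩⟩)
  obtain ⟨hA, hNA⟩ := Finset.mem_filter.1 hAG
  have hrA := hr A hA
  obtain ⟨B, hBN, hBmax⟩ := Finset.exists_max_image (N A)
    (fun k => (r A ^ 2 * (y k - y A) + r A * r k * |x k - x A|) / (r A ^ 2 + r k ^ 2)) hNA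
  obtain ⟨hB, hAB, hABo⟩ := (hN A B).1 hBN
  have hrB := hr B hB
  obtain ⟨z₁, hz⟩ := exists_corner (v₁ := x B - x A) (v₂ := y B - y A) hrA hrB
    (by linear_combination hABo)
  obtain ⟨hz, hzB⟩ := hz _ rfl
  set z₂ := (r A ^ 2 * (y B - y A) + r A * r B * |x B - x A|) / (r A ^ 2 + r B ^ 2)
  have hpA : (x A - (x A + z₁)) ^ 2 + (y A - (y A + z₂)) ^ 2 = r A ^ 2 := by
    linear_combination hz
  have hpB : (x B - (x A + z₁)) ^ 2 + (y B - (y A + z₂)) ^ 2 = r B ^ 2 := by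
    linear_combination hz + hABo - 2 * hzB
  refine ⟨A, hA, B, hB, hAB, hABo, x A + z₁, y A + z₂, hpA, hpB, fun k hk hkA hkB => ?_⟩
  have hrk := hr k hk
  have hout : ∀ i ∈ G, (r i + r k) ^ 2 < (x i - x k) ^ 2 + (y i - y k) ^ 2 →
      (x i - (x A + z₁)) ^ 2 + (y i - (y A + z₂)) ^ 2 = r i ^ 2 →
      r k ^ 2 < (x k - (x A + z₁)) ^ 2 + (y k - (y A + z₂)) ^ 2 := by
    intro i hi h hpi
    by_contra! hle
    have := sq_add_sq_sub_le (hr i hi).le hrk.le hpi.le hle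
    simp only [sub_sub_sub_cancel_right] at this
    linarith
  rcases hd A hA k hk hkA.symm with ho | hdis
  swap
  · exact hout A hA hdis hpA
  have hkN : k ∈ N A := (hN A k).2 ⟨hk, hkA.symm, ho⟩
  have htop : y k + r k ≤ y A + r A := hAmax k (Finset.mem_filter.2
    ⟨hk, A, (hN k A).2 ⟨hA, hkA, by linear_combination ho⟩⟩)
  have hle : z₁ * (x k - x A) + z₂ * (y k - y A) ≤ r A ^ 2 := by
    by_contra! hgt
    have := height_lt_of_inner_gt hrA hrk hz (by linear_combination ho) (by linarith) hgt
    exact (hBmax k hkN).not_gt this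
  rcases hle.lt_or_eq with hlt | heq
  · nlinarith
  rcases hd B hB k hk hkB.symm with hBk | hBk
  swap
  · exact hout B hB hBk hpB
  have hpk : (x k - (x A + z₁)) ^ 2 + (y k - (y A + z₂)) ^ 2 = r k ^ 2 := by
    linear_combination hz + ho - 2 * heq
  exact (not_three_orthogonal (hpA ▸ pow_pos hrA 2) (hpB ▸ pow_pos hrB 2) (hpk ▸ pow_pos hrk 2)
    (by linear_combination (hpA + hpB - hABo) / 2) (by linear_combination (hpA + hpk - ho) / 2)
    (by linear_combination (hpB + hpk - hBk) / 2)).elim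

end Corner

section Plane

variable {ι : Type*} {G : Finset ι} {x y r : ι → ℝ}

lemma mul_add_mul_of_orthonormal {a b c d : ℝ} (hab : a ^ 2 + b ^ 2 = 1) (hcd : c ^ 2 + d ^ 2 = 1)
    (h : a * c + b * d = 0) (u v u' v' : ℝ) :
    (a * u + b * v) * (a * u' + b * v') + (c * u + d * v) * (c * u' + d * v') =
      u * u' + v * v' := by
  have hc : c = -b * (a * d - b * c) := by linear_combination (-c) * hab + a * h
  have hd : d = a * (a * d - b * c) := by linear_combination (-d) * hab + b * h
  have hD : (a * d - b * c) ^ 2 = 1 := by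
    linear_combination (c ^ 2 + d ^ 2) * hab + hcd - (a * c + b * d) * h
  set D := a * d - b * c
  rw [hc, hd]
  linear_combination (b * u - a * v) * (b * u' - a * v') * hD + (u * u' + v * v') * hab

lemma inverse_dist_sq {X Y w ρ X' Y' w' ρ' : ℝ} (hw : w ≠ 0) (hw' : w' ≠ 0)
    (h : X ^ 2 + Y ^ 2 = w + ρ ^ 2) (h' : X' ^ 2 + Y' ^ 2 = w' + ρ' ^ 2) :
    (X / w - X' / w') ^ 2 + (Y / w - Y' / w') ^ 2 - ((ρ / w) ^ 2 + (ρ' / w') ^ 2) =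
      (w + w' - 2 * (X * X' + Y * Y')) / (w * w') := by
  field_simp
  linear_combination w' ^ 2 * h + w ^ 2 * h'

lemma inverse_coord_of_eq {Z w d ρ₀ ρ : ℝ} (hw : 0 < w) (hρ₀ : 0 < ρ₀)
    (hZ : 2 * ρ₀ * Z = w - (d - ρ₀ ^ 2 - ρ ^ 2)) (hd : d = ρ₀ ^ 2 + ρ ^ 2) :
    Z / w = 1 / (2 * ρ₀) := by
  rw [div_eq_div_iff hw.ne' (by positivity)]
  linear_combination hZ - hd

lemma inverse_coord_of_lt {Z w d ρ₀ ρ : ℝ} (hw : 0 < w) (hρ₀ : 0 < ρ₀)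
    (hZ : 2 * ρ₀ * Z = w - (d - ρ₀ ^ 2 - ρ ^ 2)) (hd : (ρ₀ + ρ) ^ 2 < d) :
    Z / w + ρ / w < 1 / (2 * ρ₀) := by
  rw [← add_div, div_lt_div_iff₀ hw (by positivity)]
  linarith

/-- Orthogonal or disjoint circles in the plane, at least five of them, have few orthogonal
pairs. -/
lemma card_orthogonal (hG : 5 ≤ G.card) (hr : ∀ k ∈ G, 0 < r k)
    (hd : ∀ i ∈ G, ∀ j ∈ G, i ≠ j → (x i - x j) ^ 2 + (y i - y j) ^ 2 = r i ^ 2 + r j ^ 2 ∨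
      (r i + r j) ^ 2 < (x i - x j) ^ 2 + (y i - y j) ^ 2) :
    ∃ E : Finset (ι × ι), (∀ i ∈ G, ∀ j ∈ G, i ≠ j →
        (x i - x j) ^ 2 + (y i - y j) ^ 2 = r i ^ 2 + r j ^ 2 → (i, j) ∈ E ∨ (j, i) ∈ E) ∧
      E.card + 8 ≤ 3 * G.card := by
  by_cases hne : ∃ i ∈ G, ∃ j ∈ G, i ≠ j ∧
      (x i - x j) ^ 2 + (y i - y j) ^ 2 = r i ^ 2 + r j ^ 2
  swap
  · exact ⟨∅, fun i hi j hj hij h => (hne ⟨i, hi, j, hj, hij, h⟩).elim, by simp; omega⟩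
  obtain ⟨A, hA, B, hB, hAB, hABo, p, q, hpA, hpB, hout⟩ := exists_uncovered_corner hr hd hne
  have hrA := hr A hA
  have hrB := hr B hB
  -- inversion about `(p, q)`, in the coordinates given by the lines into which `A` and `B` turn
  set X : ι → ℝ := fun k => (x A - p) / r A * (x k - p) + (y A - q) / r A * (y k - q) with hX
  set Y : ι → ℝ := fun k => (x B - p) / r B * (x k - p) + (y B - q) / r B * (y k - q) with hY
  set w : ι → ℝ := fun k => (x k - p) ^ 2 + (y k - q) ^ 2 - r k ^ 2 with hw
  have hXY : ∀ i j, X i * X j + Y i * Y j =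
      (x i - p) * (x j - p) + (y i - q) * (y j - q) := by
    intro i j
    refine mul_add_mul_of_orthonormal ?_ ?_ ?_ _ _ _ _
    · field_simp; linear_combination hpA
    · field_simp; linear_combination hpB
    · field_simp; linear_combination (hpA + hpB - hABo) / 2
  have hXA : ∀ k, 2 * r A * X k =
      w k - ((x A - x k) ^ 2 + (y A - y k) ^ 2 - r A ^ 2 - r k ^ 2) := by
    intro k
    simp only [hX, hw]; field_simp; linear_combination hpA
  have hYB : ∀ k, 2 * r B * Y k =
      w k - ((x B - x k) ^ 2 + (y B - y k) ^ 2 - r B ^ 2 - r k ^ 2) := by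
    intro k
    simp only [hY, hw]; field_simp; linear_combination hpB
  set F := (G.erase A).erase B with hF
  have hFG : ∀ k ∈ F, k ∈ G ∧ k ≠ A ∧ k ≠ B := fun k hk => by
    simp only [hF, Finset.mem_erase] at hk
    exact ⟨hk.2.2, hk.2.1, hk.1⟩
  have hFcard : F.card + 2 = G.card := by
    rw [hF, Finset.card_erase_of_mem (Finset.mem_erase.2 ⟨hAB.symm, hB⟩),
      Finset.card_erase_of_mem hA]
    omega
  have hwpos : ∀ k ∈ F, 0 < w k := fun k hk => by
    obtain ⟨hkG, hkA, hkB⟩ := hFG k hk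
    exact sub_pos.2 (hout k hkG hkA hkB)
  have hdist : ∀ i ∈ F, ∀ j ∈ F, (X i / w i - X j / w j) ^ 2 + (Y i / w i - Y j / w j) ^ 2 -
      ((r i / w i) ^ 2 + (r j / w j) ^ 2) =
      ((x i - x j) ^ 2 + (y i - y j) ^ 2 - r i ^ 2 - r j ^ 2) / (w i * w j) := by
    intro i hi j hj
    have h : (x i - x j) ^ 2 + (y i - y j) ^ 2 - r i ^ 2 - r j ^ 2 =
        w i + w j - 2 * (X i * X j + Y i * Y j) := by
      rw [hXY]; simp only [hw]; ring
    rw [h]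
    exact inverse_dist_sq (hwpos i hi).ne' (hwpos j hj).ne'
      (by simp only [hw]; linear_combination hXY i i)
      (by simp only [hw]; linear_combination hXY j j)
  have hsA : ∀ k ∈ F, X k / w k = 1 / (2 * r A) ∨ X k / w k + r k / w k < 1 / (2 * r A) :=
    fun k hk => (hd A hA k (hFG k hk).1 (hFG k hk).2.1.symm).imp
      (inverse_coord_of_eq (hwpos k hk) hrA (hXA k))
      (inverse_coord_of_lt (hwpos k hk) hrA (hXA k))
  have htB : ∀ k ∈ F, Y k / w k = 1 / (2 * r B) ∨ Y k / w k + r k / w k < 1 / (2 * r B) :=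
    fun k hk => (hd B hB k (hFG k hk).1 (hFG k hk).2.2.symm).imp
      (inverse_coord_of_eq (hwpos k hk) hrB (hYB k))
      (inverse_coord_of_lt (hwpos k hk) hrB (hYB k))
  obtain ⟨E, hE, hEcard⟩ := card_orthogonal_in_quadrant (F := F) (s := fun k => X k / w k)
    (t := fun k => Y k / w k) (r := fun k => r k / w k)
    (fun k hk => div_pos (hr k (hFG k hk).1) (hwpos k hk))
    (fun i hi j hj hij => by
      have h : 0 ≤ (x i - x j) ^ 2 + (y i - y j) ^ 2 - r i ^ 2 - r j ^ 2 := by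
        have hij' := mul_pos (hr i (hFG i hi).1) (hr j (hFG j hj).1)
        rcases hd i (hFG i hi).1 j (hFG j hj).1 hij with h | h <;> linarith
      have := div_nonneg h (mul_pos (hwpos i hi) (hwpos j hj)).le
      rw [← hdist i hi j hj] at this
      exact sub_nonneg.1 this)
    (by omega) hsA htB
  set S := F.filter fun k => X k / w k = 1 / (2 * r A)
  set T := F.filter fun k => Y k / w k = 1 / (2 * r B)
  refine ⟨insert (A, B) (S.image (Prod.mk A) ∪ T.image (Prod.mk B) ∪ E), ?_, ?_⟩
  · have hmem : ∀ k ∈ G, k ≠ A → k ≠ B → k ∈ F := fun k hk hkA hkB =>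
      Finset.mem_erase.2 ⟨hkB, Finset.mem_erase.2 ⟨hkA, hk⟩⟩
    have hfromA : ∀ k ∈ G, k ≠ A → (x A - x k) ^ 2 + (y A - y k) ^ 2 = r A ^ 2 + r k ^ 2 →
        (A, k) ∈ insert (A, B) (S.image (Prod.mk A) ∪ T.image (Prod.mk B) ∪ E) := by
      intro k hk hkA h
      by_cases hkB : k = B
      · simp [hkB]
      · have hkF := hmem k hk hkA hkB
        simp [S, hkF, inverse_coord_of_eq (hwpos k hkF) hrA (hXA k) h]
    have hfromB : ∀ k ∈ F, (x B - x k) ^ 2 + (y B - y k) ^ 2 = r B ^ 2 + r k ^ 2 →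
        (B, k) ∈ insert (A, B) (S.image (Prod.mk A) ∪ T.image (Prod.mk B) ∪ E) := by
      intro k hk h
      simp [T, hk, inverse_coord_of_eq (hwpos k hk) hrB (hYB k) h]
    intro i hi j hj hij h
    have h' : (x j - x i) ^ 2 + (y j - y i) ^ 2 = r j ^ 2 + r i ^ 2 := by linear_combination h
    by_cases hiA : i = A
    · subst hiA; exact .inl (hfromA j hj hij.symm h)
    by_cases hjA : j = A
    · subst hjA; exact .inr (hfromA i hi hij h')
    by_cases hiB : i = B
    · subst hiB; exact .inl (hfromB j (hmem j hj hjA hij.symm) h)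
    by_cases hjB : j = B
    · subst hjB; exact .inr (hfromB i (hmem i hi hiA hij) h')
    have hiF := hmem i hi hiA hiB
    have hjF := hmem j hj hjA hjB
    have := hdist i hiF j hjF
    rw [h, add_sub_cancel_left, sub_self, zero_div] at this
    rcases hE i hiF j hjF hij (sub_eq_zero.1 this) with h | h
    · exact .inl (by simp [h])
    · exact .inr (by simp [h])
  · have h1 := Finset.card_insert_le (A, B) (S.image (Prod.mk A) ∪ T.image (Prod.mk B) ∪ E)
    have h2 := Finset.card_union_le (S.image (Prod.mk A) ∪ T.image (Prod.mk B)) E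
    have h3 := Finset.card_union_le (S.image (Prod.mk A)) (T.image (Prod.mk B))
    have h4 := Finset.card_image_le (s := S) (f := Prod.mk A)
    have h5 := Finset.card_image_le (s := T) (f := Prod.mk B)
    omega

end Plane

namespace Circ

lemma dist_center_sq (A B : Circ) : dist A.center B.center ^ 2 =
    (A.center 0 - B.center 0) ^ 2 + (A.center 1 - B.center 1) ^ 2 := by
  rw [EuclideanSpace.dist_eq, Real.sq_sqrt (by positivity)]
  simp [Real.dist_eq, sq_abs]

lemma mem_points_iff (A : Circ) (p : EuclideanSpace ℝ (Fin 2)) : p ∈ A.points ↔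
    (p 0 - A.center 0) ^ 2 + (p 1 - A.center 1) ^ 2 = A.radius ^ 2 := by
  rw [points, Metric.mem_sphere, ← sq_eq_sq₀ dist_nonneg A.radius_pos.le, EuclideanSpace.dist_eq,
    Real.sq_sqrt (by positivity)]
  simp [Real.dist_eq, sq_abs]

lemma Nested.of_dist_add_le {A B : Circ} (h : dist A.center B.center + A.radius ≤ B.radius) :
    Nested A B :=
  .inl (Metric.closedBall_subset_closedBall' (by linarith))

lemma Nested.symm {A B : Circ} (h : Nested A B) : Nested B A := Or.symm h

lemma intersects_of_dist_le {A B : Circ} (hn : ¬ Nested A B)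
    (h : dist A.center B.center ≤ A.radius + B.radius) : Intersects A B := by
  have hrA := A.radius_pos
  have hrB := B.radius_pos
  have h1 : B.radius < dist A.center B.center + A.radius :=
    not_le.1 fun h => hn (.of_dist_add_le h)
  have h2 : A.radius < dist A.center B.center + B.radius :=
    not_le.1 fun h => hn (Nested.of_dist_add_le (by rwa [dist_comm])).symm
  have hD := dist_center_sq A B
  have hd : 0 < dist A.center B.center := by
    refine dist_nonneg.lt_of_ne fun h => ?_
    rw [← h] at h1 h2
    linarith
  set d := dist A.center B.center
  set a := A.radius
  set b := B.radius
  set v₁ := B.center 0 - A.center 0 with hv₁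
  set v₂ := B.center 1 - A.center 1 with hv₂
  have hv : v₁ ^ 2 + v₂ ^ 2 = d ^ 2 := by rw [hD]; ring
  set α := (d ^ 2 + a ^ 2 - b ^ 2) / (2 * d ^ 2) with hα
  have hα' : 2 * d ^ 2 * α = d ^ 2 + a ^ 2 - b ^ 2 := by rw [hα]; field_simp
  have hnn : 0 ≤ a ^ 2 / d ^ 2 - α ^ 2 := by
    have : a ^ 2 / d ^ 2 - α ^ 2 =
        ((a + b - d) * (d + b - a) * ((d + a - b) * (d + a + b))) / (2 * d ^ 2) ^ 2 := by
      rw [hα]; field_simp; ring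
    rw [this]
    exact div_nonneg (mul_nonneg (mul_nonneg (by linarith) (by linarith))
      (mul_nonneg (by linarith) (by linarith))) (by positivity)
  set β := Real.sqrt (a ^ 2 / d ^ 2 - α ^ 2)
  have hβ : d ^ 2 * (α ^ 2 + β ^ 2) = a ^ 2 := by
    rw [Real.sq_sqrt hnn]; field_simp; ring
  refine ⟨!₂[A.center 0 + (α * v₁ - β * v₂), A.center 1 + (α * v₂ + β * v₁)], ?_, ?_⟩
  · rw [mem_points_iff]
    simp only [Matrix.cons_val_zero, Matrix.cons_val_one, Matrix.cons_val_fin_one]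
    linear_combination (α ^ 2 + β ^ 2) * hv + hβ
  · rw [mem_points_iff]
    simp only [Matrix.cons_val_zero, Matrix.cons_val_one, Matrix.cons_val_fin_one]
    have e1 : B.center 0 = A.center 0 + v₁ := by rw [hv₁]; ring
    have e2 : B.center 1 = A.center 1 + v₂ := by rw [hv₂]; ring
    rw [e1, e2]
    linear_combination (α ^ 2 + β ^ 2 + 1 - 2 * α) * hv + hβ - hα'

end Circ

theorem stmt4 (𝒜 : Finset Circ) (n : ℕ) (hn : 𝒜.card = n) (h5 : 5 ≤ n)
    (hnn : (𝒜 : Set Circ).Pairwise fun X Y => ¬ Nested X Y)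
    (ho : (𝒜 : Set Circ).Pairwise fun X Y => Intersects X Y → Orthogonal X Y) :
    edgeCount 𝒜 ≤ 3 * n - 8 := by
  obtain ⟨E, hE, hcard⟩ := card_orthogonal (G := 𝒜) (x := fun C => C.center 0)
    (y := fun C => C.center 1) (r := Circ.radius) (hn ▸ h5) (fun C _ => C.radius_pos)
    (fun X hX Y hY hXY => by
      rw [← dist_center_sq]
      by_cases h : Intersects X Y
      · exact .inl (ho hX hY hXY h).2
      · refine .inr (pow_lt_pow_left₀ (not_le.1 fun hle => h ?_)
          (add_pos X.radius_pos Y.radius_pos).le two_ne_zero)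
        exact intersects_of_dist_le (hnn hX hY hXY) hle)
  have hsub : ((𝒜.powersetCard 2).filter fun e => ∃ A ∈ e, ∃ B ∈ e, A ≠ B ∧ Intersects A B) ⊆
      E.image fun e => {e.1, e.2} := by
    intro e he
    obtain ⟨he, X, hX, Y, hY, hXY, hmeet⟩ := Finset.mem_filter.1 he
    obtain ⟨hsub, hcard⟩ := Finset.mem_powersetCard.1 he
    have heq : {X, Y} = e := Finset.eq_of_subset_of_card_le
      (Finset.insert_subset hX (Finset.singleton_subset_iff.2 hY))
      (by rw [hcard, Finset.card_pair hXY])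
    have horth := (ho (hsub hX) (hsub hY) hXY hmeet).2
    rw [dist_center_sq] at horth
    rcases hE X (hsub hX) Y (hsub hY) hXY horth with h | h
    · exact Finset.mem_image.2 ⟨_, h, heq⟩
    · exact Finset.mem_image.2 ⟨_, h, (Finset.pair_comm _ _).trans heq⟩
  have := (Finset.card_le_card hsub).trans Finset.card_image_le
  rw [edgeCount]
  omega
end

section
/- Let A, B, C be three pairwise distinct circles in the Euclidean plane such that any two of them that intersect do so orthogonally, and suppose C intersects both A and B. Then either A and B do not intersect, or A and B intersect in exactly two points, exactly one of which lies in the open disk bounded by C. -/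
open scoped Classical

open Circ

theorem EuclideanSpace.mem_sphere_fin_two {x c : EuclideanSpace ℝ (Fin 2)} {r : ℝ} (hr : 0 < r) :
    x ∈ Metric.sphere c r ↔ (x 0 - c 0) ^ 2 + (x 1 - c 1) ^ 2 = r ^ 2 := by
  rw [Metric.mem_sphere, ← sq_eq_sq₀ dist_nonneg hr.le, EuclideanSpace.dist_sq_eq,
    Fin.sum_univ_two, Real.dist_eq, Real.dist_eq, sq_abs, sq_abs]

theorem EuclideanSpace.mem_ball_fin_two {x c : EuclideanSpace ℝ (Fin 2)} {r : ℝ} (hr : 0 < r) :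
    x ∈ Metric.ball c r ↔ (x 0 - c 0) ^ 2 + (x 1 - c 1) ^ 2 < r ^ 2 := by
  rw [Metric.mem_ball, ← sq_lt_sq₀ dist_nonneg hr.le, EuclideanSpace.dist_sq_eq,
    Fin.sum_univ_two, Real.dist_eq, Real.dist_eq, sq_abs, sq_abs]

/-- If `(d₀, d₁) ≠ 0`, a point `z` is determined by the dot product `x` and the cross product `y`
of `(d₀, d₁)` with `z - a`, and these can be prescribed. -/
theorem EuclideanSpace.existsUnique_dot_cross (a : EuclideanSpace ℝ (Fin 2)) {d₀ d₁ : ℝ}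
    (hd : 0 < d₀ ^ 2 + d₁ ^ 2) (x y : ℝ) :
    ∃! z : EuclideanSpace ℝ (Fin 2), d₀ * (z 0 - a 0) + d₁ * (z 1 - a 1) = x ∧
      d₀ * (z 1 - a 1) - d₁ * (z 0 - a 0) = y := by
  refine ⟨!₂[a 0 + (x * d₀ - y * d₁) / (d₀ ^ 2 + d₁ ^ 2),
    a 1 + (x * d₁ + y * d₀) / (d₀ ^ 2 + d₁ ^ 2)], ⟨?_, ?_⟩, ?_⟩
  · simp
    field_simp
    ring
  · simp
    field_simp
    ring
  · rintro z ⟨rfl, rfl⟩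
    ext i
    fin_cases i
    · simp
      field_simp
      ring
    · simp
      field_simp
      ring

/-- Two orthogonal circles meet in two points, and every circle orthogonal to both
contains exactly one of these points in its open disk. -/
theorem Circ.Orthogonal.exists_inter_eq_pair {A B C : Circ} (hAB : Orthogonal A B)
    (hCA : Orthogonal C A) (hCB : Orthogonal C B) :
    ∃ p q : EuclideanSpace ℝ (Fin 2), p ≠ q ∧ A.points ∩ B.points = {p, q} ∧
      p ∈ C.openDisk ∧ q ∉ C.openDisk := by
  obtain ⟨a, r, hr⟩ := A
  obtain ⟨b, s, hs⟩ := B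
  obtain ⟨c, t, ht⟩ := C
  have hAB := hAB.2
  have hCA := hCA.2
  have hCB := hCB.2
  simp only [EuclideanSpace.dist_sq_eq, Fin.sum_univ_two, Real.dist_eq, sq_abs] at hAB hCA hCB
  simp only [Circ.points, Circ.openDisk]
  obtain ⟨d₀, hd₀⟩ : ∃ d₀, d₀ = b 0 - a 0 := ⟨_, rfl⟩
  obtain ⟨d₁, hd₁⟩ : ∃ d₁, d₁ = b 1 - a 1 := ⟨_, rfl⟩
  obtain hb₀ : b 0 = a 0 + d₀ := by linarith
  obtain hb₁ : b 1 = a 1 + d₁ := by linarith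
  rw [hb₀, hb₁] at hAB hCB
  have hD : d₀ ^ 2 + d₁ ^ 2 = r ^ 2 + s ^ 2 := by linarith
  have hpos : 0 < d₀ ^ 2 + d₁ ^ 2 := by rw [hD]; positivity
  have hrs : 0 < r * s := mul_pos hr hs
  -- The coordinates of `c` in the frame spanned by `b - a` and its rotation.
  obtain ⟨y, hy⟩ : ∃ y, y = d₀ * (c 1 - a 1) - d₁ * (c 0 - a 0) := ⟨_, rfl⟩
  have hx : d₀ * (c 0 - a 0) + d₁ * (c 1 - a 1) = r ^ 2 := by linarith
  have hlagrange (u v : ℝ) :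
      (d₀ ^ 2 + d₁ ^ 2) * (u ^ 2 + v ^ 2) = (d₀ * u + d₁ * v) ^ 2 + (d₀ * v - d₁ * u) ^ 2 := by
    ring
  have hysq : y ^ 2 = (r * s) ^ 2 + t ^ 2 * (r ^ 2 + s ^ 2) := by
    have := hlagrange (c 0 - a 0) (c 1 - a 1)
    rw [hx, ← hy, hCA, hD] at this
    linarith
  have hylt : r * s < |y| := by
    refine lt_of_pow_lt_pow_left₀ 2 (abs_nonneg y) ?_
    rw [sq_abs, hysq]
    have : 0 < t ^ 2 * (r ^ 2 + s ^ 2) := by positivity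
    linarith
  obtain ⟨ε, hε, hεy⟩ : ∃ ε : ℝ, ε ^ 2 = 1 ∧ ε * y = |y| := by
    rcases le_total 0 y with h | h
    · exact ⟨1, by norm_num, by rw [abs_of_nonneg h, one_mul]⟩
    · exact ⟨-1, by norm_num, by rw [abs_of_nonpos h, neg_one_mul]⟩
  have hmem (z : EuclideanSpace ℝ (Fin 2)) : z ∈ Metric.sphere a r ∩ Metric.sphere b s ↔
      d₀ * (z 0 - a 0) + d₁ * (z 1 - a 1) = r ^ 2 ∧
        (d₀ * (z 1 - a 1) - d₁ * (z 0 - a 0)) ^ 2 = (r * s) ^ 2 := by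
    rw [Set.mem_inter_iff, EuclideanSpace.mem_sphere_fin_two hr,
      EuclideanSpace.mem_sphere_fin_two hs, hb₀, hb₁]
    have hz := hlagrange (z 0 - a 0) (z 1 - a 1)
    rw [hD] at hz
    constructor
    · rintro ⟨h₁, h₂⟩
      have hdot : d₀ * (z 0 - a 0) + d₁ * (z 1 - a 1) = r ^ 2 := by linarith
      refine ⟨hdot, ?_⟩
      rw [hdot, h₁] at hz
      linarith
    · rintro ⟨h₁, h₂⟩
      rw [h₁, h₂] at hz
      have hnorm : (z 0 - a 0) ^ 2 + (z 1 - a 1) ^ 2 = r ^ 2 :=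
        mul_left_cancel₀ (hD ▸ hpos.ne') (hz.trans (by ring))
      exact ⟨hnorm, by linarith⟩
  have hball (z : EuclideanSpace ℝ (Fin 2)) (h : d₀ * (z 0 - a 0) + d₁ * (z 1 - a 1) = r ^ 2) :
      z ∈ Metric.ball c t ↔
        (d₀ * (z 1 - a 1) - d₁ * (z 0 - a 0) - y) ^ 2 < (r ^ 2 + s ^ 2) * t ^ 2 := by
    have hz := hlagrange (z 0 - c 0) (z 1 - c 1)
    have hdot : d₀ * (z 0 - c 0) + d₁ * (z 1 - c 1) = 0 := by linarith
    have hcross : d₀ * (z 1 - c 1) - d₁ * (z 0 - c 0) =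
        d₀ * (z 1 - a 1) - d₁ * (z 0 - a 0) - y := by rw [hy]; ring
    rw [hdot, hcross, zero_pow two_ne_zero, zero_add] at hz
    rw [EuclideanSpace.mem_ball_fin_two ht, ← hz, ← hD, mul_lt_mul_iff_right₀ hpos]
  obtain ⟨p, ⟨hpx, hpy⟩, hp⟩ :=
    EuclideanSpace.existsUnique_dot_cross a hpos (r ^ 2) (ε * (r * s))
  obtain ⟨q, ⟨hqx, hqy⟩, hq⟩ :=
    EuclideanSpace.existsUnique_dot_cross a hpos (r ^ 2) (-(ε * (r * s)))
  have hsq : (ε * (r * s)) ^ 2 = (r * s) ^ 2 := by rw [mul_pow, hε, one_mul]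
  refine ⟨p, q, ?_, ?_, ?_, ?_⟩
  · rintro rfl
    have h0 : ε * (r * s) = 0 := by linarith
    rw [h0] at hsq
    exact (pow_pos hrs 2).ne (by linarith)
  · ext z
    rw [hmem, ← hsq, sq_eq_sq_iff_eq_or_eq_neg, Set.mem_insert_iff, Set.mem_singleton_iff]
    constructor
    · rintro ⟨hx, h | h⟩
      · exact Or.inl (hp z ⟨hx, h⟩)
      · exact Or.inr (hq z ⟨hx, h⟩)
    · rintro (rfl | rfl)
      · exact ⟨hpx, Or.inl hpy⟩
      · exact ⟨hqx, Or.inr hqy⟩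
  · rw [hball p hpx, hpy]
    have h : (ε * (r * s) - y) ^ 2 = (ε * (r * s)) ^ 2 - 2 * (r * s) * (ε * y) + y ^ 2 := by ring
    rw [h, hsq, hysq, hεy]
    linarith [mul_lt_mul_of_pos_left hylt hrs]
  · rw [hball q hqx, hqy, not_lt]
    have h : (-(ε * (r * s)) - y) ^ 2 = (ε * (r * s)) ^ 2 + 2 * (r * s) * (ε * y) + y ^ 2 := by ring
    rw [h, hsq, hysq, hεy]
    linarith [mul_lt_mul_of_pos_left hylt hrs, sq_nonneg (r * s)]

theorem stmt6 (A B C : Circ) (hAB : A ≠ B) (hAC : A ≠ C) (hBC : B ≠ C)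
    (ho : ({A, B, C} : Set Circ).Pairwise fun X Y => Intersects X Y → Orthogonal X Y)
    (hCA : Intersects C A) (hCB : Intersects C B) :
    ¬ Intersects A B ∨
      ∃ p q : EuclideanSpace ℝ (Fin 2), p ≠ q ∧ A.points ∩ B.points = {p, q} ∧
        p ∈ C.openDisk ∧ q ∉ C.openDisk := by
  refine or_iff_not_imp_left.2 fun h => ?_
  exact (ho (by simp) (by simp) hAB (not_not.1 h)).exists_inter_eq_pair
    (ho (by simp) (by simp) hAC.symm hCA) (ho (by simp) (by simp) hBC.symm hCB)
end

section
/- Every finite arrangement of orthogonal circles that contains at least one nested pair of circles has a circle C of depth t(C) = 1 that intersects at most seven circles of the arrangement of depth at least 1. -/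
open scoped Classical

open Circ

/-- The depth of a circle `C` in an arrangement `𝒜`: the maximum cardinality of a set of
pairwise nested circles of `𝒜` that are properly contained in `C`. -/
noncomputable def depth (𝒜 : Finset Circ) (C : Circ) : ℕ :=
  (𝒜.powerset.filter fun S : Finset Circ =>
      (∀ D ∈ S, D.closedDisk ⊆ C.openDisk) ∧ (S : Set Circ).Pairwise Nested).sup Finset.card

namespace Circ

/-- The circle `A` lies strictly inside the circle `B`. -/
def Inside (A B : Circ) : Prop := dist A.center B.center + A.radius < B.radius

/-- Every closed disk has a point at the largest conceivable distance from a given point. -/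
lemma exists_far_point (A : Circ) (p : EuclideanSpace ℝ (Fin 2)) :
    ∃ q ∈ A.closedDisk, dist q p = dist A.center p + A.radius := by
  have key : ∃ u : EuclideanSpace ℝ (Fin 2), ‖u‖ = 1 ∧ A.center - p = dist A.center p • u := by
    by_cases h : A.center = p
    · exact ⟨EuclideanSpace.single 0 1, by simp, by simp [h]⟩
    · have h0 : ‖A.center - p‖ ≠ 0 := norm_ne_zero_iff.2 (sub_ne_zero.2 h)
      refine ⟨‖A.center - p‖⁻¹ • (A.center - p), ?_, ?_⟩
      · rw [norm_smul, norm_inv, norm_norm, inv_mul_cancel₀ h0]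
      · rw [dist_eq_norm, smul_smul, mul_inv_cancel₀ h0, one_smul]
  obtain ⟨u, hu, hc⟩ := key
  have hr := A.radius_pos
  refine ⟨A.center + A.radius • u, ?_, ?_⟩
  · simp [closedDisk, dist_eq_norm, norm_smul, hu, abs_of_pos hr]
  · have h2 : A.center + A.radius • u - p = (dist A.center p + A.radius) • u := by
      rw [add_smul, ← hc]; abel
    rw [dist_eq_norm, h2, norm_smul, hu, mul_one, Real.norm_eq_abs, abs_of_nonneg]
    have := dist_nonneg (x := A.center) (y := p)
    linarith

lemma closedDisk_subset_openDisk_iff {A B : Circ} :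
    A.closedDisk ⊆ B.openDisk ↔ Inside A B := by
  constructor
  · intro h
    obtain ⟨q, hq, hd⟩ := exists_far_point A B.center
    have := h hq
    simp only [openDisk, Metric.mem_ball] at this
    unfold Inside
    linarith
  · intro h q hq
    simp only [openDisk, closedDisk, Metric.mem_ball, Metric.mem_closedBall] at *
    unfold Inside at h
    linarith [dist_triangle q A.center B.center]

lemma dist_add_radius_le_of_closedDisk_subset {A B : Circ} (h : A.closedDisk ⊆ B.closedDisk) :
    dist A.center B.center + A.radius ≤ B.radius := by
  obtain ⟨q, hq, hd⟩ := exists_far_point A B.center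
  have := h hq
  simp only [closedDisk, Metric.mem_closedBall] at this
  linarith

lemma Inside.trans {A B C : Circ} (h : Inside A B) (h' : Inside B C) : Inside A C := by
  unfold Inside at *
  linarith [dist_triangle A.center B.center C.center, B.radius_pos]

lemma Inside.radius_lt {A B : Circ} (h : Inside A B) : A.radius < B.radius := by
  unfold Inside at h
  linarith [dist_nonneg (x := A.center) (y := B.center)]

lemma dist_sq_eq (p q : EuclideanSpace ℝ (Fin 2)) :
    dist p q ^ 2 = (p 0 - q 0) ^ 2 + (p 1 - q 1) ^ 2 := by
  rw [EuclideanSpace.dist_sq_eq, Fin.sum_univ_two, Real.dist_eq, Real.dist_eq, sq_abs, sq_abs]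

/-- Circles satisfying the triangle inequalities for their radii and center distance intersect. -/
lemma intersects_of_le {A B : Circ} (hd : 0 < dist A.center B.center)
    (h₁ : dist A.center B.center ≤ A.radius + B.radius)
    (h₂ : B.radius ≤ dist A.center B.center + A.radius)
    (h₃ : A.radius ≤ dist A.center B.center + B.radius) : Intersects A B := by
  have hsq := dist_sq_eq A.center B.center
  have hA := A.radius_pos
  have hB := B.radius_pos
  set d := dist A.center B.center
  set x := B.center 0 - A.center 0 with hx
  set y := B.center 1 - A.center 1 with hy
  have hxy : d ^ 2 = x ^ 2 + y ^ 2 := by rw [hsq]; ring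
  set a := (d ^ 2 + A.radius ^ 2 - B.radius ^ 2) / (2 * d) with ha
  have had : 2 * a * d = d ^ 2 + A.radius ^ 2 - B.radius ^ 2 := by rw [ha]; field_simp
  have hnn : 0 ≤ A.radius ^ 2 - a ^ 2 := by
    have e : 4 * d ^ 2 * (A.radius ^ 2 - a ^ 2) =
        ((A.radius + B.radius - d) * (d + A.radius + B.radius)) *
          ((d + A.radius - B.radius) * (d + B.radius - A.radius)) := by
      have : (2 * a * d) ^ 2 = (d ^ 2 + A.radius ^ 2 - B.radius ^ 2) ^ 2 := by rw [had]
      linear_combination -this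
    have h0 : 0 ≤ 4 * d ^ 2 * (A.radius ^ 2 - a ^ 2) := by
      rw [e]
      exact mul_nonneg (mul_nonneg (by linarith) (by linarith))
        (mul_nonneg (by linarith) (by linarith))
    exact nonneg_of_mul_nonneg_right h0 (by positivity)
  set h := Real.sqrt (A.radius ^ 2 - a ^ 2)
  have hh : h ^ 2 = A.radius ^ 2 - a ^ 2 := Real.sq_sqrt hnn
  have hxy1 : (x / d) ^ 2 + (y / d) ^ 2 = 1 := by
    field_simp
    exact hxy.symm
  have hX : x = d * (x / d) := by field_simp
  have hY : y = d * (y / d) := by field_simp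
  set c := x / d
  set s := y / d
  refine ⟨!₂[A.center 0 + a * c - h * s, A.center 1 + a * s + h * c], ?_, ?_⟩
  · rw [points, Metric.mem_sphere, ← sq_eq_sq₀ dist_nonneg hA.le, dist_sq_eq]
    simp only [Matrix.cons_val_zero, Matrix.cons_val_one]
    linear_combination (a ^ 2 + h ^ 2) * hxy1 + hh
  · rw [points, Metric.mem_sphere, ← sq_eq_sq₀ dist_nonneg hB.le, dist_sq_eq]
    simp only [Matrix.cons_val_zero, Matrix.cons_val_one]
    have e0 : B.center 0 = A.center 0 + d * c := by rw [← hX, hx]; ring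
    have e1 : B.center 1 = A.center 1 + d * s := by rw [← hY, hy]; ring
    rw [e0, e1]
    linear_combination ((a - d) ^ 2 + h ^ 2) * hxy1 + hh - had

/-- The possible positions of two circles that do not intersect. -/
lemma disjoint_or_inside {A B : Circ} (hI : ¬ Intersects A B) :
    A.radius + B.radius < dist A.center B.center ∨ Inside A B ∨ Inside B A := by
  by_contra! hcon
  obtain ⟨h₁, h₂, h₃⟩ := hcon
  unfold Inside at h₂ h₃
  rw [dist_comm B.center] at h₃
  push Not at h₂ h₃
  rcases (dist_nonneg (x := A.center) (y := B.center)).eq_or_lt with h0 | h0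
  · have hc : A.center = B.center := dist_eq_zero.1 h0.symm
    have hr : A.radius = B.radius := by linarith
    apply hI
    have hp : A.points = B.points := by rw [points, points, hc, hr]
    rw [Intersects, hp, Set.inter_self]
    exact NormedSpace.sphere_nonempty.2 B.radius_pos.le
  · exact hI (intersects_of_le h0 h₁ h₂ h₃)

/-- Center of `A` in coordinates in which `C` is the unit circle: first coordinate. -/
noncomputable def relX (C A : Circ) : ℝ := (A.center 0 - C.center 0) / C.radius

/-- Center of `A` in coordinates in which `C` is the unit circle: second coordinate. -/
noncomputable def relY (C A : Circ) : ℝ := (A.center 1 - C.center 1) / C.radius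

/-- Radius of `A` in coordinates in which `C` is the unit circle. -/
noncomputable def relR (C A : Circ) : ℝ := A.radius / C.radius

lemma relR_pos (C A : Circ) : 0 < relR C A := div_pos A.radius_pos C.radius_pos

lemma dist_sq_eq_rel (C A B : Circ) : dist A.center B.center ^ 2 =
    C.radius ^ 2 * ((relX C A - relX C B) ^ 2 + (relY C A - relY C B) ^ 2) := by
  have := C.radius_pos.ne'
  rw [dist_sq_eq, relX, relX, relY, relY]
  field_simp
  ring

lemma radius_eq_rel (C A : Circ) : A.radius = C.radius * relR C A := by
  have := C.radius_pos.ne'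
  rw [relR]
  field_simp

lemma rel_norm_sq {C A : Circ} (h : dist C.center A.center ^ 2 = C.radius ^ 2 + A.radius ^ 2) :
    relX C A ^ 2 + relY C A ^ 2 = 1 + relR C A ^ 2 := by
  have h0 := C.radius_pos
  rw [dist_sq_eq_rel C, radius_eq_rel C A] at h
  have e0 : relX C C = 0 := by simp [relX]
  have e1 : relY C C = 0 := by simp [relY]
  rw [e0, e1] at h
  have : C.radius ^ 2 * (relX C A ^ 2 + relY C A ^ 2) = C.radius ^ 2 * (1 + relR C A ^ 2) := by
    linear_combination h
  exact mul_left_cancel₀ (by positivity) this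

section Inner

variable {C A B : Circ} (hA : relX C A ^ 2 + relY C A ^ 2 = 1 + relR C A ^ 2)
  (hB : relX C B ^ 2 + relY C B ^ 2 = 1 + relR C B ^ 2)
include hA hB

lemma rel_inner_of_orthogonal (h : dist A.center B.center ^ 2 = A.radius ^ 2 + B.radius ^ 2) :
    relX C A * relX C B + relY C A * relY C B = 1 := by
  have h0 := C.radius_pos
  rw [dist_sq_eq_rel C, radius_eq_rel C A, radius_eq_rel C B] at h
  have : (relX C A - relX C B) ^ 2 + (relY C A - relY C B) ^ 2 = relR C A ^ 2 + relR C B ^ 2 :=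
    mul_left_cancel₀ (pow_ne_zero 2 h0.ne') (by linear_combination h)
  linear_combination (hA + hB - this) / 2

lemma rel_inner_of_disjoint (h : A.radius + B.radius < dist A.center B.center) :
    relX C A * relX C B + relY C A * relY C B < 1 - relR C A * relR C B := by
  have h0 := C.radius_pos
  have h2 : (A.radius + B.radius) ^ 2 < dist A.center B.center ^ 2 :=
    pow_lt_pow_left₀ h (by linarith [A.radius_pos, B.radius_pos]) two_ne_zero
  rw [dist_sq_eq_rel C, radius_eq_rel C A, radius_eq_rel C B, ← mul_add, mul_pow] at h2
  have := lt_of_mul_lt_mul_left h2 (by positivity)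
  linarith

lemma rel_inner_of_inside (h : Inside A B) :
    1 + relR C A * relR C B < relX C A * relX C B + relY C A * relY C B := by
  have h0 := C.radius_pos
  unfold Inside at h
  have h2 : dist A.center B.center ^ 2 < (B.radius - A.radius) ^ 2 :=
    pow_lt_pow_left₀ (by linarith) dist_nonneg two_ne_zero
  rw [dist_sq_eq_rel C, radius_eq_rel C A, radius_eq_rel C B, ← mul_sub, mul_pow] at h2
  have := lt_of_mul_lt_mul_left h2 (by positivity)
  linarith

end Inner

end Circ

/-! ### Packing vectors in the plane, in coordinates with respect to a hexagonal basis -/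

/-- Two long vectors in a common half-open sextant have large inner product. -/
lemma one_lt_hex_inner {a b c d : ℝ} (ha : 0 < a) (hb : 0 ≤ b) (hc : 0 < c) (hd : 0 ≤ d)
    (h₁ : 2 ≤ a ^ 2 + a * b + b ^ 2) (h₂ : 2 ≤ c ^ 2 + c * d + d ^ 2) :
    1 < a * c + b * d + (a * d + b * c) / 2 := by
  set P := a ^ 2 + a * b + b ^ 2
  set R := c ^ 2 + c * d + d ^ 2
  set I := a * c + b * d + (a * d + b * c) / 2
  have hI : 0 < I := by positivity
  have hid : I ^ 2 + 3 / 4 * (a * d - b * c) ^ 2 = P * R := by simp only [I, P, R]; ring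
  have hlt : (a * d - b * c) ^ 2 < P * R := by
    have h3 : P * R - (a * d - b * c) ^ 2 = a ^ 2 * c ^ 2 + a ^ 2 * c * d + a * b * c ^ 2 +
        3 * (a * b * c * d) + a * b * d ^ 2 + b ^ 2 * c * d + b ^ 2 * d ^ 2 := by
      simp only [P, R]; ring
    have : 0 < P * R - (a * d - b * c) ^ 2 := by rw [h3]; positivity
    linarith
  have h4 : 4 ≤ P * R := by nlinarith
  nlinarith

/-- If the clockwise neighbor of a long vector along a sextant boundary is long and at
angle at least `π / 3`, then it lies on the previous sextant boundary, and both are shortest. -/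
lemma hex_boundary {a b c : ℝ} (ha : 0 < a) (hb : 0 ≤ b) (hc : 0 < c)
    (h₁ : 2 ≤ a ^ 2 + a * b + b ^ 2) (h₂ : 2 ≤ c ^ 2) (h : b * c + a * c / 2 ≤ 1) :
    b = 0 ∧ a = √2 ∧ c = √2 := by
  have h3 : ((a + 2 * b) * c) ^ 2 ≤ 2 ^ 2 :=
    pow_le_pow_left₀ (by positivity) (by linarith) 2
  have h4 : (a + 2 * b) ^ 2 * c ^ 2 ≤ 4 := by linarith [mul_pow (a + 2 * b) c 2]
  have h5 : (a + 2 * b) ^ 2 * 2 ≤ 4 :=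
    (mul_le_mul_of_nonneg_left h₂ (sq_nonneg _)).trans h4
  have hb0 : b = 0 := by
    by_contra hne
    have : 0 < b := lt_of_le_of_ne hb (Ne.symm hne)
    nlinarith [mul_pos ha this]
  subst hb0
  have ha2 : a ^ 2 = 2 := by nlinarith
  have hc2 : c ^ 2 = 2 := by nlinarith
  exact ⟨rfl, (Real.sqrt_eq_iff_eq_sq (by norm_num) ha.le).2 ha2.symm |>.symm,
    (Real.sqrt_eq_iff_eq_sq (by norm_num) hc.le).2 hc2.symm |>.symm⟩

/-- The index of the half-open sextant containing a vector, in hexagonal coordinates. -/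
noncomputable def sextant (x y : ℝ) : Fin 6 :=
  if 0 < x ∧ 0 ≤ y then 0
  else if x ≤ 0 ∧ 0 < x + y then 1
  else if 0 < y ∧ x + y ≤ 0 then 2
  else if x < 0 ∧ y ≤ 0 then 3
  else if 0 ≤ x ∧ x + y < 0 then 4
  else 5

lemma sextant_spec {x y : ℝ} (h : x ≠ 0 ∨ y ≠ 0) :
    (sextant x y = 0 ∧ 0 < x ∧ 0 ≤ y) ∨ (sextant x y = 1 ∧ x ≤ 0 ∧ 0 < x + y) ∨
    (sextant x y = 2 ∧ 0 < y ∧ x + y ≤ 0) ∨ (sextant x y = 3 ∧ x < 0 ∧ y ≤ 0) ∨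
    (sextant x y = 4 ∧ 0 ≤ x ∧ x + y < 0) ∨ (sextant x y = 5 ∧ y < 0 ∧ 0 ≤ x + y) := by
  unfold sextant
  split_ifs with h0 h1 h2 h3 h4
  · simp [h0]
  · simp [h1]
  · simp [h2]
  · simp [h3]
  · simp [h4]
  · have : y < 0 ∧ 0 ≤ x + y := by
      rcases lt_trichotomy y 0 with hy | hy | hy
      · refine ⟨hy, ?_⟩
        by_contra hc
        rcases lt_or_ge x 0 with hx | hx
        · exact h3 ⟨hx, hy.le⟩
        · exact h4 ⟨hx, by linarith⟩
      · subst hy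
        rcases lt_trichotomy x 0 with hx | hx | hx
        · exact absurd ⟨hx, le_rfl⟩ h3
        · simp [hx] at h
        · exact absurd ⟨hx, le_rfl⟩ h0
      · exfalso
        rcases lt_or_ge 0 x with hx | hx
        · exact h0 ⟨hx, hy.le⟩
        · rcases lt_or_ge 0 (x + y) with hxy | hxy
          · exact h1 ⟨hx, hxy⟩
          · exact h2 ⟨hy, hxy⟩
    simp [this]

section Packing

variable {ι : Type*} {Z : Finset ι} {x y : ι → ℝ}
  (hQ : ∀ i ∈ Z, 2 ≤ x i ^ 2 + x i * y i + y i ^ 2)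
  (hI : ∀ i ∈ Z, ∀ j ∈ Z, i ≠ j → x i * x j + y i * y j + (x i * y j + y i * x j) / 2 ≤ 1)
include hQ

lemma hex_ne_zero {i : ι} (hi : i ∈ Z) : x i ≠ 0 ∨ y i ≠ 0 := by
  by_contra! h
  have := hQ i hi
  norm_num [h.1, h.2] at this

include hI

lemma sextant_injOn : Set.InjOn (fun i => sextant (x i) (y i)) (Z : Set ι) := by
  intro i hi j hj hij
  by_contra hne
  have hle := hI i hi j hj hne
  have hi2 := hQ i hi
  have hj2 := hQ j hj
  have hs := sextant_spec (hex_ne_zero hQ hi)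
  have ht := sextant_spec (hex_ne_zero hQ hj)
  simp only at hij
  rw [hij] at hs
  rcases ht with ht | ht | ht | ht | ht | ht <;> obtain ⟨ht0, ht1, ht2⟩ := ht <;>
    simp [ht0] at hs <;> obtain ⟨hs1, hs2⟩ := hs
  · linarith [one_lt_hex_inner hs1 hs2 ht1 ht2 hi2 hj2]
  · linarith [one_lt_hex_inner (a := x i + y i) (b := -x i) (c := x j + y j) (d := -x j)
      hs2 (by linarith) ht2 (by linarith) (by linarith) (by linarith)]
  · linarith [one_lt_hex_inner (a := y i) (b := -(x i + y i)) (c := y j) (d := -(x j + y j))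
      hs1 (by linarith) ht1 (by linarith) (by linarith) (by linarith)]
  · linarith [one_lt_hex_inner (a := -x i) (b := -y i) (c := -x j) (d := -y j)
      (by linarith) (by linarith) (by linarith) (by linarith) (by linarith) (by linarith)]
  · linarith [one_lt_hex_inner (a := -(x i + y i)) (b := x i) (c := -(x j + y j)) (d := x j)
      (by linarith) (by linarith) (by linarith) (by linarith) (by linarith) (by linarith)]
  · linarith [one_lt_hex_inner (a := -y i) (b := x i + y i) (c := -y j) (d := x j + y j)
      (by linarith) (by linarith) (by linarith) (by linarith) (by linarith) (by linarith)]

/-- At most six vectors of length at least `√2` have pairwise inner products at most one. -/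
lemma card_le_six : Z.card ≤ 6 := by
  simpa using Finset.card_le_card_of_injOn (fun i => sextant (x i) (y i))
    (t := Finset.univ) (fun _ _ => by simp) (sextant_injOn hQ hI)

/-- Six vectors of length at least `√2` with pairwise inner products at most one form a regular
hexagon. -/
lemma hexagon_of_card_eq_six (h6 : Z.card = 6) {i₀ : ι} (hi₀ : i₀ ∈ Z) (hy₀ : y i₀ = 0)
    (hx₀ : 0 < x i₀) :
    (∃ i ∈ Z, x i = √2 ∧ y i = 0) ∧ (∃ i ∈ Z, x i = 0 ∧ y i = √2) ∧
    (∃ i ∈ Z, x i = -√2 ∧ y i = √2) ∧ (∃ i ∈ Z, x i = -√2 ∧ y i = 0) ∧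
    (∃ i ∈ Z, x i = 0 ∧ y i = -√2) ∧ (∃ i ∈ Z, x i = √2 ∧ y i = -√2) := by
  have hsurj : ∀ k : Fin 6, ∃ i ∈ Z, sextant (x i) (y i) = k := by
    have himg : Z.image (fun i => sextant (x i) (y i)) = Finset.univ := by
      apply Finset.eq_univ_of_card
      rw [Finset.card_image_of_injOn (sextant_injOn hQ hI), h6]
      rfl
    intro k
    have : k ∈ Z.image (fun i => sextant (x i) (y i)) := by rw [himg]; simp
    simpa using this
  have hs0 : sextant (x i₀) (y i₀) = 0 := by simp [sextant, hy₀, hx₀]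
  obtain ⟨i₁, hi₁, h1⟩ := hsurj 1
  obtain ⟨i₂, hi₂, h2⟩ := hsurj 2
  obtain ⟨i₃, hi₃, h3⟩ := hsurj 3
  obtain ⟨i₄, hi₄, h4⟩ := hsurj 4
  obtain ⟨i₅, hi₅, h5⟩ := hsurj 5
  have s1 := sextant_spec (hex_ne_zero hQ hi₁)
  have s2 := sextant_spec (hex_ne_zero hQ hi₂)
  have s3 := sextant_spec (hex_ne_zero hQ hi₃)
  have s4 := sextant_spec (hex_ne_zero hQ hi₄)
  have s5 := sextant_spec (hex_ne_zero hQ hi₅)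
  simp [h1] at s1
  simp [h2] at s2
  simp [h3] at s3
  simp [h4] at s4
  simp [h5] at s5
  have hne {i j : ι} {k l : Fin 6} (hi : sextant (x i) (y i) = k) (hj : sextant (x j) (y j) = l)
      (hkl : k ≠ l) : i ≠ j := by
    rintro rfl
    exact hkl (hi.symm.trans hj)
  have q0 := hQ _ hi₀
  have q1 := hQ _ hi₁
  have q2 := hQ _ hi₂
  have q3 := hQ _ hi₃
  have q4 := hQ _ hi₄
  have q5 := hQ _ hi₅
  have I50 := hI _ hi₅ _ hi₀ (hne h5 hs0 (by decide))
  have I45 := hI _ hi₄ _ hi₅ (hne h4 h5 (by decide))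
  have I34 := hI _ hi₃ _ hi₄ (hne h3 h4 (by decide))
  have I23 := hI _ hi₂ _ hi₃ (hne h2 h3 (by decide))
  have I12 := hI _ hi₁ _ hi₂ (hne h1 h2 (by decide))
  rw [hy₀] at I50 q0
  have hr : (0 : ℝ) < √2 := by positivity
  obtain ⟨b5, a5, c5⟩ := hex_boundary (a := -y i₅) (b := x i₅ + y i₅) (c := x i₀)
    (by linarith) (by linarith) hx₀ (by linarith) (by linarith) (by linarith)
  have hy5 : y i₅ = -√2 := by linarith
  have hx5 : x i₅ = √2 := by linarith
  rw [hy5, hx5] at I45 q5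
  obtain ⟨b4, a4, -⟩ := hex_boundary (a := -(x i₄ + y i₄)) (b := x i₄) (c := √2)
    (by linarith) (by linarith) hr (by linarith) (by linarith) (by linarith)
  have hy4 : y i₄ = -√2 := by linarith
  rw [hy4, b4] at I34
  obtain ⟨b3, a3, -⟩ := hex_boundary (a := -x i₃) (b := -y i₃) (c := √2)
    (by linarith) (by linarith) hr (by linarith) (by linarith) (by linarith)
  have hx3 : x i₃ = -√2 := by linarith
  have hy3 : y i₃ = 0 := by linarith
  rw [hx3, hy3] at I23
  obtain ⟨b2, a2, -⟩ := hex_boundary (a := y i₂) (b := -(x i₂ + y i₂)) (c := √2)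
    (by linarith) (by linarith) hr (by linarith) (by linarith) (by linarith)
  have hx2 : x i₂ = -√2 := by linarith
  rw [hx2, a2] at I12
  obtain ⟨b1, a1, -⟩ := hex_boundary (a := x i₁ + y i₁) (b := -x i₁) (c := √2)
    (by linarith) (by linarith) hr (by linarith) (by linarith) (by linarith)
  exact ⟨⟨i₀, hi₀, c5, hy₀⟩, ⟨i₁, hi₁, by linarith, by linarith⟩, ⟨i₂, hi₂, hx2, a2⟩,
    ⟨i₃, hi₃, hx3, hy3⟩, ⟨i₄, hi₄, b4, hy4⟩, ⟨i₅, hi₅, hx5, hy5⟩⟩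

end Packing

/-- The possible inner products of the centers of a unit circle and a circle of radius `s`,
both orthogonal to the unit circle around the origin, when the two circles are disjoint,
orthogonal, or the unit circle is inside the other one. -/
def AdmissibleInner (s t : ℝ) : Prop := t < 1 - s ∨ t = 1 ∨ (1 < s ∧ 1 + s < t)

/-- No circle fits around a hexagon of unit circles. -/
lemma not_admissible_hexagon {s X Y : ℝ} (hs : 0 < s)
    (hsum : X ^ 2 + Y ^ 2 + (Y - X) ^ 2 = 3 * (1 + s ^ 2))
    (hX : AdmissibleInner s X) (hX' : AdmissibleInner s (-X))
    (hY : AdmissibleInner s Y) (hY' : AdmissibleInner s (-Y))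
    (hZ : AdmissibleInner s (Y - X)) (hZ' : AdmissibleInner s (-(Y - X))) : False := by
  have key : ∀ t, AdmissibleInner s t → AdmissibleInner s (-t) →
      (s < 1 → t ^ 2 ≤ 1) ∧ (1 ≤ s → (t = 1 ∧ s < 2) ∨ (t = -1 ∧ s < 2) ∨ 1 + s < t ∨
        t < -(1 + s)) := by
    intro t h h'
    constructor
    · intro hs1
      rw [sq_le_one_iff_abs_le_one, abs_le]
      rcases h with h | h | h <;> rcases h' with h' | h' | h' <;>
        constructor <;> linarith
    · intro hs1
      rcases h with h | h | h <;> rcases h' with h' | h' | h' <;>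
        first
        | exact Or.inl ⟨by linarith, by linarith⟩
        | exact Or.inr (Or.inl ⟨by linarith, by linarith⟩)
        | exact Or.inr (Or.inr (Or.inl (by linarith)))
        | exact Or.inr (Or.inr (Or.inr (by linarith)))
  obtain ⟨x1, x2⟩ := key X hX hX'
  obtain ⟨y1, y2⟩ := key Y hY hY'
  obtain ⟨z1, z2⟩ := key (Y - X) hZ hZ'
  rcases lt_or_ge s 1 with h | h
  · nlinarith [x1 h, y1 h, z1 h]
  · rcases x2 h with ⟨h1, h1'⟩ | ⟨h1, h1'⟩ | h1 | h1 <;>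
    rcases y2 h with ⟨h2, h2'⟩ | ⟨h2, h2'⟩ | h2 | h2 <;>
    rcases z2 h with ⟨h3, h3'⟩ | ⟨h3, h3'⟩ | h3 | h3 <;>
    first
    | linarith
    | nlinarith

namespace Circ

/-- A circle `C` has at most six neighbors that are no smaller than `C` and pairwise
orthogonal or disjoint; if there are six, they leave no room for a further neighbor of `C`. -/
lemma card_large_neighbors {C : Circ} {E : Finset Circ}
    (hC : ∀ A ∈ E, dist C.center A.center ^ 2 = C.radius ^ 2 + A.radius ^ 2)
    (hr : ∀ A ∈ E, C.radius ≤ A.radius)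
    (hE : ∀ A ∈ E, ∀ B ∈ E, A ≠ B → dist A.center B.center ^ 2 = A.radius ^ 2 + B.radius ^ 2 ∨
      A.radius + B.radius < dist A.center B.center) :
    E.card ≤ 6 ∧ (E.card = 6 → ∀ D : Circ,
      dist C.center D.center ^ 2 = C.radius ^ 2 + D.radius ^ 2 →
      ¬ ∀ A ∈ E, dist A.center D.center ^ 2 = A.radius ^ 2 + D.radius ^ 2 ∨
        A.radius + D.radius < dist A.center D.center ∨ Inside A D) := by
  rcases E.eq_empty_or_nonempty with rfl | ⟨A₀, hA₀⟩
  · simp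
  have hs : ∀ A ∈ E, 1 ≤ relR C A := fun A hA => (one_le_div C.radius_pos).2 (hr A hA)
  have hn : ∀ A ∈ E, relX C A ^ 2 + relY C A ^ 2 = 1 + relR C A ^ 2 :=
    fun A hA => rel_norm_sq (hC A hA)
  have hin : ∀ A ∈ E, ∀ B ∈ E, A ≠ B → relX C A * relX C B + relY C A * relY C B ≤ 1 := by
    intro A hA B hB hAB
    rcases hE A hA B hB hAB with h | h
    · exact (rel_inner_of_orthogonal (hn A hA) (hn B hB) h).le
    · have := rel_inner_of_disjoint (hn A hA) (hn B hB) h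
      nlinarith [relR_pos C A, relR_pos C B]
  set m := √(relX C A₀ ^ 2 + relY C A₀ ^ 2) with hm
  have hm0 : 0 < m := Real.sqrt_pos.2 (by rw [hn A₀ hA₀]; positivity)
  have hm2 : m ^ 2 = relX C A₀ ^ 2 + relY C A₀ ^ 2 := Real.sq_sqrt (by positivity)
  set c := relX C A₀ / m with hc
  set s := relY C A₀ / m with hsdef
  have hcs : c ^ 2 + s ^ 2 = 1 := by
    rw [hc, hsdef]
    field_simp
    exact hm2.symm
  set w := √3 with hw
  have hw0 : w ≠ 0 := by positivity
  have hw2 : w ^ 2 = 3 := Real.sq_sqrt (by norm_num)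
  -- hexagonal coordinates whose first axis points to the center of `A₀`
  let y : Circ → ℝ := fun A => 2 * (c * relY C A - s * relX C A) / w
  let x : Circ → ℝ := fun A => c * relX C A + s * relY C A - (c * relY C A - s * relX C A) / w
  have hinner : ∀ A B, x A * x B + y A * y B + (x A * y B + y A * x B) / 2 =
      relX C A * relX C B + relY C A * relY C B := by
    intro A B
    set p := c * relX C A + s * relY C A with hp
    set q := c * relY C A - s * relX C A with hq
    set p' := c * relX C B + s * relY C B with hp'
    set q' := c * relY C B - s * relX C B with hq'
    have e : x A * x B + y A * y B + (x A * y B + y A * x B) / 2 = p * p' + q * q' := by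
      simp only [x, y, ← hp, ← hq, ← hp', ← hq']
      field_simp
      linear_combination -(q * q') * hw2
    rw [e, hp, hq, hp', hq']
    linear_combination (relX C A * relX C B + relY C A * relY C B) * hcs
  have hsq : ∀ A, x A ^ 2 + x A * y A + y A ^ 2 = relX C A ^ 2 + relY C A ^ 2 := by
    intro A
    linear_combination hinner A A
  have hQ : ∀ A ∈ E, 2 ≤ x A ^ 2 + x A * y A + y A ^ 2 := by
    intro A hA
    rw [hsq, hn A hA]
    nlinarith [hs A hA]
  have hI : ∀ A ∈ E, ∀ B ∈ E, A ≠ B →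
      x A * x B + y A * y B + (x A * y B + y A * x B) / 2 ≤ 1 := by
    intro A hA B hB hAB
    rw [hinner]
    exact hin A hA B hB hAB
  refine ⟨card_le_six hQ hI, fun h6 D hD hDE => ?_⟩
  have hy₀ : y A₀ = 0 := by
    simp only [y, hc, hsdef]
    field_simp
    ring
  have hx₀ : 0 < x A₀ := by
    have : x A₀ = m := by
      have h0 : c * relY C A₀ - s * relX C A₀ = 0 := by rw [hc, hsdef]; ring
      simp only [x]
      rw [h0, zero_div, sub_zero, hc, hsdef]
      field_simp
      exact hm2.symm
    rw [this]
    exact hm0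
  have hDn := rel_norm_sq hD
  have hadm : ∀ A ∈ E, x A ^ 2 + x A * y A + y A ^ 2 = 2 → AdmissibleInner (relR C D)
      (x A * x D + y A * y D + (x A * y D + y A * x D) / 2) := by
    intro A hA h2
    rw [hsq, hn A hA] at h2
    have hR : relR C A = 1 := by nlinarith [hs A hA]
    rw [hinner]
    rcases hDE A hA with h | h | h
    · exact Or.inr (Or.inl (rel_inner_of_orthogonal (hn A hA) hDn h))
    · have := rel_inner_of_disjoint (hn A hA) hDn h
      rw [hR, one_mul] at this
      exact Or.inl this
    · have := rel_inner_of_inside (hn A hA) hDn h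
      rw [hR, one_mul] at this
      refine Or.inr (Or.inr ⟨?_, this⟩)
      rw [← hR]
      exact div_lt_div_of_pos_right h.radius_lt C.radius_pos
  have h22 : √2 ^ 2 = (2 : ℝ) := Real.sq_sqrt (by norm_num)
  have hadm' : ∀ a b : ℝ, (∃ A ∈ E, x A = a ∧ y A = b) → a ^ 2 + a * b + b ^ 2 = 2 →
      AdmissibleInner (relR C D) (a * x D + b * y D + (a * y D + b * x D) / 2) := by
    rintro a b ⟨A, hA, rfl, rfl⟩ h
    exact hadm A hA h
  obtain ⟨g0, g1, g2, g3, g4, g5⟩ := hexagon_of_card_eq_six hQ hI h6 hA₀ hy₀ hx₀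
  have a0 := hadm' _ _ g0 (by linear_combination h22)
  have a1 := hadm' _ _ g1 (by linear_combination h22)
  have a2 := hadm' _ _ g2 (by linear_combination h22)
  have a3 := hadm' _ _ g3 (by linear_combination h22)
  have a4 := hadm' _ _ g4 (by linear_combination h22)
  have a5 := hadm' _ _ g5 (by linear_combination h22)
  refine not_admissible_hexagon (s := relR C D) (X := √2 * (x D + y D / 2))
    (Y := √2 * (y D + x D / 2)) (relR_pos C D) ?_ ?_ ?_ ?_ ?_ ?_ ?_
  · rw [← hDn, ← hsq]
    linear_combination
      (3 / 2 * (x D ^ 2 + x D * y D + y D ^ 2)) * h22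
  · convert a0 using 1; ring
  · convert a3 using 1; ring
  · convert a1 using 1; ring
  · convert a4 using 1; ring
  · convert a2 using 1; ring
  · convert a5 using 1; ring

/-- Two nested disjoint circles have at most two common neighbors. -/
lemma card_common_neighbors_le_two {C B : Circ} (hCB : Inside C B) {S : Finset Circ}
    (hC : ∀ D ∈ S, dist C.center D.center ^ 2 = C.radius ^ 2 + D.radius ^ 2)
    (hB : ∀ D ∈ S, dist D.center B.center ^ 2 = D.radius ^ 2 + B.radius ^ 2)
    (hS : ∀ D ∈ S, ∀ D' ∈ S, D ≠ D' →
      dist D.center D'.center ^ 2 = D.radius ^ 2 + D'.radius ^ 2 ∨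
      D.radius + D'.radius < dist D.center D'.center ∨ Inside D D' ∨ Inside D' D) :
    S.card ≤ 2 := by
  have hR := relR_pos C B
  set b₁ := relX C B
  set b₂ := relY C B
  set R := relR C B
  set n := √(b₁ ^ 2 + b₂ ^ 2)
  have hn0 : 0 ≤ n := Real.sqrt_nonneg _
  have hn2 : n ^ 2 = b₁ ^ 2 + b₂ ^ 2 := Real.sq_sqrt (by positivity)
  have hlt : n + 1 < R := by
    have h0 := C.radius_pos
    have hd : dist C.center B.center = C.radius * n := by
      rw [← sq_eq_sq₀ dist_nonneg (by positivity), mul_pow, hn2, dist_sq_eq_rel C]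
      simp [relX, relY, b₁, b₂]
    have : Inside C B := hCB
    unfold Inside at this
    rw [hd, radius_eq_rel C B] at this
    nlinarith
  have hCn := fun D hD => rel_norm_sq (hC D hD)
  have hk : ∀ D ∈ S, relX C D * b₁ + relY C D * b₂ = (1 + n ^ 2 - R ^ 2) / 2 := by
    intro D hD
    have h := hB D hD
    have h0 := C.radius_pos
    rw [dist_sq_eq_rel C, radius_eq_rel C D, radius_eq_rel C B] at h
    have : (relX C D - b₁) ^ 2 + (relY C D - b₂) ^ 2 = relR C D ^ 2 + R ^ 2 :=
      mul_left_cancel₀ (pow_ne_zero 2 h0.ne') (by linear_combination h)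
    linear_combination (hCn D hD - this - hn2) / 2
  set k := (1 + n ^ 2 - R ^ 2) / 2 with hkdef
  have hkn : n < -k := by rw [hkdef]; nlinarith
  let t : Circ → ℝ := fun D => relX C D * b₂ - relY C D * b₁
  have hdot : ∀ D ∈ S, ∀ D' ∈ S, n ^ 2 * (relX C D * relX C D' + relY C D * relY C D') =
      k ^ 2 + t D * t D' := by
    intro D hD D' hD'
    have h1 := hk D hD
    have h2 := hk D' hD'
    rw [hn2]
    simp only [t]
    linear_combination (relX C D' * b₁ + relY C D' * b₂) * h1 + k * h2
  have hneg : ∀ D ∈ S, ∀ D' ∈ S, D ≠ D' → t D * t D' < 0 := by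
    intro D hD D' hD' hne
    have e := hdot D hD D' hD'
    have e1 := hdot D hD D hD
    have e2 := hdot D' hD' D' hD'
    have n1 := hCn D hD
    have n2 := hCn D' hD'
    have p1 := relR_pos C D
    have p2 := relR_pos C D'
    set r := relR C D
    set r' := relR C D'
    have hkk : 0 < k ^ 2 - n ^ 2 := by nlinarith
    have f1 : n ^ 2 * r ^ 2 = (k ^ 2 - n ^ 2) + t D ^ 2 := by linear_combination e1 - n ^ 2 * n1
    have f2 : n ^ 2 * r' ^ 2 = (k ^ 2 - n ^ 2) + t D' ^ 2 := by
      linear_combination e2 - n ^ 2 * n2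
    have hcs : |k ^ 2 - n ^ 2 + t D * t D'| ≤ n ^ 2 * (r * r') := by
      apply abs_le_of_sq_le_sq _ (by positivity)
      have : (n ^ 2 * (r * r')) ^ 2 =
          ((k ^ 2 - n ^ 2) + t D ^ 2) * ((k ^ 2 - n ^ 2) + t D' ^ 2) := by
        rw [← f1, ← f2]; ring
      rw [this]
      nlinarith [mul_nonneg hkk.le (sq_nonneg (t D - t D'))]
    obtain ⟨c1, c2⟩ := abs_le.1 hcs
    have hnn : 0 < n ^ 2 := by
      rw [hn2]
      by_contra hcon
      have hb₁ : b₁ = 0 :=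
        (pow_eq_zero_iff two_ne_zero).1 (by linarith [sq_nonneg b₁, sq_nonneg b₂])
      have hb₂ : b₂ = 0 :=
        (pow_eq_zero_iff two_ne_zero).1 (by linarith [sq_nonneg b₁, sq_nonneg b₂])
      have := hk D hD
      rw [hb₁, hb₂] at this
      linarith
    rcases hS D hD D' hD' hne with h | h | h | h
    · rw [rel_inner_of_orthogonal n1 n2 h] at e
      linarith
    · have := mul_lt_mul_of_pos_left (rel_inner_of_disjoint n1 n2 h) hnn
      linarith
    · have := mul_lt_mul_of_pos_left (rel_inner_of_inside n1 n2 h) hnn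
      linarith
    · have := mul_lt_mul_of_pos_left (rel_inner_of_inside n2 n1 h) hnn
      linarith
  by_contra! hcard
  obtain ⟨D₁, h₁, D₂, h₂, D₃, h₃, h12, h13, h23⟩ := Finset.two_lt_card.1 hcard
  have p12 := hneg _ h₁ _ h₂ h12
  have p13 := hneg _ h₁ _ h₃ h13
  have p23 := hneg _ h₂ _ h₃ h23
  have := mul_pos_of_neg_of_neg p12 p13
  nlinarith [sq_nonneg (t D₁), mul_nonneg (sq_nonneg (t D₁)) (sq_nonneg (t D₂))]

/-- A circle `C` with at most two neighbors outside of `E`, none of which is inside a circle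
of `E`, has at most seven neighbors. -/
lemma card_neighbors_le_seven {C : Circ} {E S : Finset Circ}
    (hC : ∀ A ∈ E, dist C.center A.center ^ 2 = C.radius ^ 2 + A.radius ^ 2)
    (hr : ∀ A ∈ E, C.radius ≤ A.radius)
    (hE : ∀ A ∈ E, ∀ B ∈ E, A ≠ B → dist A.center B.center ^ 2 = A.radius ^ 2 + B.radius ^ 2 ∨
      A.radius + B.radius < dist A.center B.center)
    (hS : S.card ≤ 2)
    (hSC : ∀ D ∈ S, dist C.center D.center ^ 2 = C.radius ^ 2 + D.radius ^ 2)
    (hSE : ∀ D ∈ S, ∀ A ∈ E, dist A.center D.center ^ 2 = A.radius ^ 2 + D.radius ^ 2 ∨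
        A.radius + D.radius < dist A.center D.center ∨ Inside A D) :
    E.card + S.card ≤ 7 := by
  obtain ⟨h6, hex⟩ := card_large_neighbors hC hr hE
  rcases S.eq_empty_or_nonempty with rfl | ⟨D, hD⟩
  · simp only [Finset.card_empty]
    omega
  · have : E.card ≠ 6 := fun h => hex h D (hSC D hD) (hSE D hD)
    omega

section Arrangement

variable {𝒜 : Finset Circ}

lemma one_le_depth_iff {C : Circ} : 1 ≤ depth 𝒜 C ↔ ∃ X ∈ 𝒜, Inside X C := by
  unfold depth
  constructor
  · intro h
    obtain ⟨S, hS, hcard⟩ := Finset.lt_sup_iff.1 (Nat.lt_of_succ_le h)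
    obtain ⟨X, hX⟩ := Finset.card_pos.1 hcard
    simp only [Finset.mem_filter, Finset.mem_powerset] at hS
    exact ⟨X, hS.1 hX, closedDisk_subset_openDisk_iff.1 (hS.2.1 X hX)⟩
  · rintro ⟨X, hX, hXC⟩
    refine le_trans (by simp) (Finset.le_sup (f := Finset.card) (b := {X}) ?_)
    simp [hX, closedDisk_subset_openDisk_iff, hXC]

variable (ho : (𝒜 : Set Circ).Pairwise fun X Y => Intersects X Y → Orthogonal X Y)
include ho

lemma orthogonal_or_disjoint_or_inside {A B : Circ} (hA : A ∈ 𝒜) (hB : B ∈ 𝒜) (hAB : A ≠ B) :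
    dist A.center B.center ^ 2 = A.radius ^ 2 + B.radius ^ 2 ∨
      A.radius + B.radius < dist A.center B.center ∨ Inside A B ∨ Inside B A := by
  by_cases h : Intersects A B
  · exact Or.inl (ho hA hB hAB h).2
  · exact Or.inr (disjoint_or_inside h)

lemma inside_of_nested {A B : Circ} (hA : A ∈ 𝒜) (hB : B ∈ 𝒜) (hAB : A ≠ B)
    (h : A.closedDisk ⊆ B.closedDisk) : Inside A B := by
  have h1 := dist_add_radius_le_of_closedDisk_subset h
  have hd := dist_nonneg (x := A.center) (y := B.center)
  have hA0 := A.radius_pos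
  rcases orthogonal_or_disjoint_or_inside ho hA hB hAB with h2 | h2 | h2 | h2
  · have : dist A.center B.center ^ 2 ≤ (B.radius - A.radius) ^ 2 :=
      pow_le_pow_left₀ hd (by linarith) 2
    nlinarith [mul_pos hA0 B.radius_pos]
  · linarith
  · exact h2
  · linarith [h2.radius_lt]

lemma two_le_depth {C : Circ} (h : 2 ≤ depth 𝒜 C) :
    ∃ Y ∈ 𝒜, 1 ≤ depth 𝒜 Y ∧ Inside Y C := by
  unfold depth at h
  obtain ⟨S, hS, hcard⟩ := Finset.lt_sup_iff.1 (Nat.lt_of_succ_le h)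
  obtain ⟨X, hX, Y, hY, hXY⟩ := Finset.one_lt_card.1 hcard
  simp only [Finset.mem_filter, Finset.mem_powerset] at hS
  obtain ⟨hS1, hS2, hS3⟩ := hS
  rcases hS3 hX hY hXY with h' | h'
  · exact ⟨Y, hS1 hY, one_le_depth_iff.2
      ⟨X, hS1 hX, inside_of_nested ho (hS1 hX) (hS1 hY) hXY h'⟩,
      closedDisk_subset_openDisk_iff.1 (hS2 Y hY)⟩
  · exact ⟨X, hS1 hX, one_le_depth_iff.2
      ⟨Y, hS1 hY, inside_of_nested ho (hS1 hY) (hS1 hX) hXY.symm h'⟩,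
      closedDisk_subset_openDisk_iff.1 (hS2 X hX)⟩

/-- Let `C` be a deep circle of minimal radius among the deep circles of `𝒜` that satisfy `P`.
If no deep circle lies inside another one satisfying `P`, and at most two deep neighbors of `C`
violate `P`, none of them inside a circle satisfying `P`, then `C` has few deep neighbors. -/
lemma card_deep_neighbors_le_seven {C : Circ} (hC : C ∈ 𝒜) (P : Circ → Prop)
    (hmin : ∀ D ∈ 𝒜, 1 ≤ depth 𝒜 D → P D → C.radius ≤ D.radius)
    (hP : ∀ A ∈ 𝒜, ∀ B ∈ 𝒜, 1 ≤ depth 𝒜 A → P B → ¬ Inside A B)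
    (hS : (𝒜.filter fun D => (D ≠ C ∧ Intersects C D ∧ 1 ≤ depth 𝒜 D) ∧ ¬ P D).card ≤ 2) :
    (𝒜.filter fun D => D ≠ C ∧ Intersects C D ∧ 1 ≤ depth 𝒜 D).card ≤ 7 := by
  have hsplit := Finset.card_filter_add_card_filter_not
    (s := 𝒜.filter fun D => D ≠ C ∧ Intersects C D ∧ 1 ≤ depth 𝒜 D) P
  rw [Finset.filter_filter, Finset.filter_filter] at hsplit
  rw [← hsplit]
  refine card_neighbors_le_seven (C := C) ?_ ?_ ?_ hS ?_ ?_ <;>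
    simp only [Finset.mem_filter]
  · rintro A ⟨hA, ⟨hne, hI, -⟩, -⟩
    exact (ho hC hA hne.symm hI).2
  · rintro A ⟨hA, ⟨-, -, hd⟩, hPA⟩
    exact hmin A hA hd hPA
  · rintro A ⟨hA, ⟨-, -, hdA⟩, hPA⟩ B ⟨hB, ⟨-, -, hdB⟩, hPB⟩ hAB
    rcases orthogonal_or_disjoint_or_inside ho hA hB hAB with h | h | h | h
    · exact Or.inl h
    · exact Or.inr h
    · exact absurd h (hP A hA B hB hdA hPB)
    · exact absurd h (hP B hB A hA hdB hPA)
  · rintro A ⟨hA, ⟨hne, hI, -⟩, -⟩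
    exact (ho hC hA hne.symm hI).2
  · rintro D ⟨hD, ⟨-, -, hdD⟩, hPD⟩ A ⟨hA, -, hPA⟩
    have hAD : A ≠ D := by
      rintro rfl
      exact hPD hPA
    rcases orthogonal_or_disjoint_or_inside ho hA hD hAD with h | h | h | h
    · exact Or.inl h
    · exact Or.inr (Or.inl h)
    · exact Or.inr (Or.inr h)
    · exact absurd h (hP D hD A hA hdD hPA)

/-- A circle that intersects a circle inside `B`, but is not inside `B`, intersects `B`
orthogonally. -/
lemma orthogonal_of_neighbor_of_inside {B C D : Circ} (hB : B ∈ 𝒜) (hC : C ∈ 𝒜) (hD : D ∈ 𝒜)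
    (hDC : D ≠ C) (hCD : Intersects C D) (hCB : Inside C B) (hDB : ¬ Inside D B) :
    dist D.center B.center ^ 2 = D.radius ^ 2 + B.radius ^ 2 := by
  have horth := (ho hC hD hDC.symm hCD).2
  have hC0 := C.radius_pos
  have hD0 := D.radius_pos
  have hclose : dist C.center D.center < C.radius + D.radius := by
    nlinarith [mul_pos hC0 hD0]
  have hnot : ¬ Inside C D := by
    unfold Inside
    intro h
    nlinarith [mul_pos hC0 hD0, dist_nonneg (x := C.center) (y := D.center)]
  have hne : D ≠ B := by
    rintro rfl
    exact hnot hCB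
  rcases orthogonal_or_disjoint_or_inside ho hD hB hne with h | h | h | h
  · exact h
  · exfalso
    have := hCB
    unfold Inside at this
    have := dist_triangle D.center C.center B.center
    rw [dist_comm D.center C.center] at this
    linarith
  · exact absurd h hDB
  · exact absurd (hCB.trans h) hnot

end Arrangement

end Circ

theorem stmt8 (𝒜 : Finset Circ)
    (ho : (𝒜 : Set Circ).Pairwise fun X Y => Intersects X Y → Orthogonal X Y)
    (hnest : ∃ A ∈ 𝒜, ∃ B ∈ 𝒜, A ≠ B ∧ Nested A B) :
    ∃ C ∈ 𝒜, depth 𝒜 C = 1 ∧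
      (𝒜.filter fun D => D ≠ C ∧ Intersects C D ∧ 1 ≤ depth 𝒜 D).card ≤ 7 := by
  obtain ⟨A, hA, B, hB, hAB, hN⟩ := hnest
  have hdeep : ∃ D ∈ 𝒜, 1 ≤ depth 𝒜 D := by
    rcases hN with h | h
    · exact ⟨B, hB, one_le_depth_iff.2 ⟨A, hA, inside_of_nested ho hA hB hAB h⟩⟩
    · exact ⟨A, hA, one_le_depth_iff.2 ⟨B, hB, inside_of_nested ho hB hA hAB.symm h⟩⟩
  by_cases hdeep2 : ∃ B ∈ 𝒜, ∃ Y ∈ 𝒜, 1 ≤ depth 𝒜 Y ∧ Inside Y B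
  · obtain ⟨B₀, hB₀, hB₀'⟩ := hdeep2
    obtain ⟨B, hBmem, hBmin⟩ := Finset.exists_min_image
      (𝒜.filter fun B => ∃ Y ∈ 𝒜, 1 ≤ depth 𝒜 Y ∧ Inside Y B) radius
      ⟨B₀, Finset.mem_filter.2 ⟨hB₀, hB₀'⟩⟩
    obtain ⟨hB, Y, hY, hYd, hYB⟩ := Finset.mem_filter.1 hBmem
    obtain ⟨C, hCmem, hCmin⟩ := Finset.exists_min_image
      (𝒜.filter fun C => 1 ≤ depth 𝒜 C ∧ Inside C B) radius
      ⟨Y, Finset.mem_filter.2 ⟨hY, hYd, hYB⟩⟩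
    obtain ⟨hC, hCd, hCB⟩ := Finset.mem_filter.1 hCmem
    have hP : ∀ A ∈ 𝒜, ∀ D ∈ 𝒜, 1 ≤ depth 𝒜 A → Inside D B → ¬ Inside A D := by
      intro A hA D hD hAd hDB hAD
      have := hBmin D (Finset.mem_filter.2 ⟨hD, A, hA, hAd, hAD⟩)
      linarith [hDB.radius_lt]
    refine ⟨C, hC, le_antisymm ?_ hCd, card_deep_neighbors_le_seven ho hC (Inside · B)
      (fun D hD hDd hDB => hCmin D (Finset.mem_filter.2 ⟨hD, hDd, hDB⟩)) hP
      (card_common_neighbors_le_two hCB ?_ ?_ ?_)⟩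
    · by_contra! h
      obtain ⟨A, hA, hAd, hAC⟩ := two_le_depth ho h
      exact hP A hA C hC hAd hCB hAC
    all_goals simp only [Finset.mem_filter]
    · rintro D ⟨hD, ⟨hne, hI, -⟩, -⟩
      exact (ho hC hD hne.symm hI).2
    · rintro D ⟨hD, ⟨hne, hI, -⟩, hDB⟩
      exact orthogonal_of_neighbor_of_inside ho hB hC hD hne hI hCB hDB
    · rintro D ⟨hD, -⟩ D' ⟨hD', -⟩ hne
      exact orthogonal_or_disjoint_or_inside ho hD hD' hne
  · have hP : ∀ A ∈ 𝒜, ∀ D ∈ 𝒜, 1 ≤ depth 𝒜 A → True → ¬ Inside A D :=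
      fun A hA D hD hAd _ hAD => hdeep2 ⟨D, hD, A, hA, hAd, hAD⟩
    obtain ⟨D₀, hD₀, hD₀'⟩ := hdeep
    obtain ⟨C, hCmem, hCmin⟩ := Finset.exists_min_image
      (𝒜.filter fun C => 1 ≤ depth 𝒜 C) radius ⟨D₀, Finset.mem_filter.2 ⟨hD₀, hD₀'⟩⟩
    obtain ⟨hC, hCd⟩ := Finset.mem_filter.1 hCmem
    refine ⟨C, hC, le_antisymm ?_ hCd, card_deep_neighbors_le_seven ho hC (fun _ => True)
      (fun D hD hDd _ => hCmin D (Finset.mem_filter.2 ⟨hD, hDd⟩)) hP (by simp)⟩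
    by_contra! h
    obtain ⟨A, hA, hAd, hAC⟩ := two_le_depth ho h
    exact hP A hA C hC hAd trivial hAC
end

section
/- Let 𝒜 be an arrangement of orthogonal circles, let C ∈ 𝒜, and let I_C be the set of deep circles of 𝒜 that intersect C. If |I_C| ≤ 7, then the set of points of the plane lying on at least two circles of I_C has cardinality at most 16, and at most 8 of these points lie in the open disk bounded by C. -/
open scoped Classical

open Circ

/-- In a graph without triangles and without 4-cycles on `n` vertices, the squares of the degrees
sum to at most `n * (n - 1)`. -/
lemma sum_degree_sq_add_card_le {V : Type*} [Fintype V] (G : SimpleGraph V)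
    [DecidableRel G.Adj]
    (h3 : ∀ u v w, G.Adj u v → G.Adj v w → G.Adj u w → False)
    (h4 : ∀ u v w x, u ≠ v → G.Adj u w → G.Adj v w → G.Adj u x → G.Adj v x → w = x) :
    ∑ v, G.degree v ^ 2 + Fintype.card V ≤ Fintype.card V ^ 2 := by
  have hdeg (v : V) : G.degree v = ∑ u, if G.Adj v u then 1 else 0 := by
    rw [← SimpleGraph.card_neighborFinset_eq_degree, SimpleGraph.neighborFinset_eq_filter,
      Finset.card_filter]
  have hpair (u v : V) :
      (∑ w, if G.Adj w u ∧ G.Adj w v then 1 else 0) + (if G.Adj u v then 1 else 0) +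
        (if u = v then 1 else 0) ≤ 1 + if u = v then G.degree u else 0 := by
    by_cases huv : u = v
    · subst huv
      simp [hdeg u, G.adj_comm]
    · simp only [huv, if_false, add_zero]
      rw [← Finset.card_filter]
      by_cases ha : G.Adj u v
      · have : (Finset.univ.filter fun w => G.Adj w u ∧ G.Adj w v) = ∅ := by
          ext w
          simpa using fun h1 h2 => h3 w u v h1 ha h2
        simp [this, ha]
      · simp only [ha, if_false, add_zero]
        refine Finset.card_le_one.2 fun w hw x hx => ?_
        simp only [Finset.mem_filter, Finset.mem_univ, true_and] at hw hx
        exact h4 u v w x huv hw.1.symm hw.2.symm hx.1.symm hx.2.symm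
  have hsum := Finset.sum_le_sum fun u (_ : u ∈ Finset.univ) =>
    Finset.sum_le_sum fun v (_ : v ∈ Finset.univ) => hpair u v
  have hsq : ∑ u, ∑ v, ∑ w, (if G.Adj w u ∧ G.Adj w v then 1 else 0) = ∑ w, G.degree w ^ 2 := by
    calc _ = ∑ u, ∑ w, ∑ v, (if G.Adj w u ∧ G.Adj w v then 1 else 0) :=
          Finset.sum_congr rfl fun u _ => Finset.sum_comm
      _ = ∑ w, ∑ u, ∑ v, (if G.Adj w u ∧ G.Adj w v then 1 else 0) := Finset.sum_comm
      _ = _ := by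
          refine Finset.sum_congr rfl fun w _ => ?_
          rw [hdeg w, sq, Finset.sum_mul_sum]
          simp only [ite_and, mul_ite, mul_one, mul_zero]
          refine Finset.sum_congr rfl fun u _ => Finset.sum_congr rfl fun v _ => ?_
          split_ifs <;> rfl
  simp only [Finset.sum_add_distrib, hsq, ← hdeg] at hsum
  simp only [Finset.sum_ite_eq, Finset.mem_univ, if_true, Finset.sum_const, Finset.card_univ,
    smul_eq_mul, mul_one] at hsum
  rw [sq (Fintype.card V)]
  lia

/-- A graph without triangles and 4-cycles on at most 7 vertices has at most 8 edges. -/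
lemma card_edgeFinset_le_eight {V : Type*} [Fintype V] (G : SimpleGraph V)
    [DecidableRel G.Adj]
    (h3 : ∀ u v w, G.Adj u v → G.Adj v w → G.Adj u w → False)
    (h4 : ∀ u v w x, u ≠ v → G.Adj u w → G.Adj v w → G.Adj u x → G.Adj v x → w = x)
    (hV : Fintype.card V ≤ 7) : G.edgeFinset.card ≤ 8 := by
  have hsq := sum_degree_sq_add_card_le G h3 h4
  have hlin : ∑ v, 5 * G.degree v ≤ ∑ v, (G.degree v ^ 2 + 6) := by
    refine Finset.sum_le_sum fun v _ => ?_
    rcases Nat.lt_or_ge (G.degree v) 3 with h | h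
    · interval_cases G.degree v <;> norm_num
    · nlinarith
  rw [← Finset.mul_sum, G.sum_degrees_eq_twice_card_edges, Finset.sum_add_distrib] at hlin
  simp only [Finset.sum_const, Finset.card_univ, smul_eq_mul] at hlin
  nlinarith

/-- Three plane vectors with pairwise inner products `k > 0` cannot all have squared norm
greater than `k`. -/
lemma not_pairwise_inner_eq {k x₁ y₁ x₂ y₂ x₃ y₃ : ℝ} (hk : 0 < k)
    (h₁ : k < x₁ ^ 2 + y₁ ^ 2) (h₂ : k < x₂ ^ 2 + y₂ ^ 2) (h₃ : k < x₃ ^ 2 + y₃ ^ 2)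
    (h₁₂ : x₁ * x₂ + y₁ * y₂ = k) (h₂₃ : x₂ * x₃ + y₂ * y₃ = k) (h₁₃ : x₁ * x₃ + y₁ * y₃ = k) :
    False := by
  have gram : (x₁ ^ 2 + y₁ ^ 2) * (x₂ ^ 2 + y₂ ^ 2) * (x₃ ^ 2 + y₃ ^ 2) +
      2 * (x₁ * x₂ + y₁ * y₂) * (x₂ * x₃ + y₂ * y₃) * (x₁ * x₃ + y₁ * y₃) -
      (x₁ ^ 2 + y₁ ^ 2) * (x₂ * x₃ + y₂ * y₃) ^ 2 - (x₂ ^ 2 + y₂ ^ 2) * (x₁ * x₃ + y₁ * y₃) ^ 2 -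
      (x₃ ^ 2 + y₃ ^ 2) * (x₁ * x₂ + y₁ * y₂) ^ 2 = 0 := by ring
  rw [h₁₂, h₂₃, h₁₃] at gram
  obtain ⟨a, ha⟩ : ∃ a, a = x₁ ^ 2 + y₁ ^ 2 - k := ⟨_, rfl⟩
  obtain ⟨b, hb⟩ : ∃ b, b = x₂ ^ 2 + y₂ ^ 2 - k := ⟨_, rfl⟩
  obtain ⟨c, hc⟩ : ∃ c, c = x₃ ^ 2 + y₃ ^ 2 - k := ⟨_, rfl⟩
  have ha0 : 0 < a := by linarith
  have hb0 : 0 < b := by linarith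
  have hc0 : 0 < c := by linarith
  rw [show x₁ ^ 2 + y₁ ^ 2 = a + k by linarith, show x₂ ^ 2 + y₂ ^ 2 = b + k by linarith,
    show x₃ ^ 2 + y₃ ^ 2 = c + k by linarith] at gram
  have : 0 < a * b * c + k * (a * b + b * c + a * c) := by positivity
  linarith

/-- For `k ≠ 0`, at most one plane vector has inner product `k` with each of two given distinct
vectors. -/
lemma eq_of_inner_eq {k x₁ y₁ x₂ y₂ u₁ v₁ u₂ v₂ : ℝ} (hk : k ≠ 0)
    (h₁₁ : x₁ * u₁ + y₁ * v₁ = k) (h₂₁ : x₂ * u₁ + y₂ * v₁ = k)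
    (h₁₂ : x₁ * u₂ + y₁ * v₂ = k) (h₂₂ : x₂ * u₂ + y₂ * v₂ = k)
    (hne : ¬(x₁ = x₂ ∧ y₁ = y₂)) : u₁ = u₂ ∧ v₁ = v₂ := by
  have hdet : (u₁ * v₂ - u₂ * v₁) = 0 := by
    by_contra hd
    refine hne ⟨?_, ?_⟩ <;> apply mul_left_cancel₀ hd
    · linear_combination v₂ * h₁₁ - v₂ * h₂₁ - v₁ * h₁₂ + v₁ * h₂₂
    · linear_combination u₁ * h₁₂ - u₁ * h₂₂ - u₂ * h₁₁ + u₂ * h₂₁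
  constructor <;> apply mul_left_cancel₀ hk
  · linear_combination (-u₁) * h₁₂ + u₂ * h₁₁ + y₁ * hdet
  · linear_combination (-v₁) * h₁₂ + v₂ * h₁₁ - x₁ * hdet

/-- The common points of two circles that are orthogonal to the circle of squared radius `k` about
the origin are collinear with the origin. -/
lemma cross_eq_zero_of_mem_inter {k p₁ p₂ q₁ q₂ x₁ x₂ y₁ y₂ : ℝ}
    (hpq : ¬(p₁ = q₁ ∧ p₂ = q₂))
    (hxp : x₁ ^ 2 + x₂ ^ 2 + k = 2 * (x₁ * p₁ + x₂ * p₂))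
    (hxq : x₁ ^ 2 + x₂ ^ 2 + k = 2 * (x₁ * q₁ + x₂ * q₂))
    (hyp : y₁ ^ 2 + y₂ ^ 2 + k = 2 * (y₁ * p₁ + y₂ * p₂))
    (hyq : y₁ ^ 2 + y₂ ^ 2 + k = 2 * (y₁ * q₁ + y₂ * q₂)) :
    x₁ * y₂ - x₂ * y₁ = 0 := by
  by_contra hd
  refine hpq ⟨?_, ?_⟩ <;> apply mul_left_cancel₀ hd
  · linear_combination (y₂ * (hxq - hxp) - x₂ * (hyq - hyp)) / 2
  · linear_combination (x₁ * (hyq - hyp) - y₁ * (hxq - hxp)) / 2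

/-- Two distinct points of a circle orthogonal to the circle of squared radius `k` about the origin
have inner product `k` if they are collinear with the origin. -/
lemma inner_eq_of_cross_eq_zero {k p₁ p₂ x₁ x₂ y₁ y₂ : ℝ}
    (hxy : ¬(x₁ = y₁ ∧ x₂ = y₂)) (hdet : x₁ * y₂ - x₂ * y₁ = 0)
    (hxp : x₁ ^ 2 + x₂ ^ 2 + k = 2 * (x₁ * p₁ + x₂ * p₂))
    (hyp : y₁ ^ 2 + y₂ ^ 2 + k = 2 * (y₁ * p₁ + y₂ * p₂)) :
    x₁ * y₁ + x₂ * y₂ = k := by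
  by_contra hne
  have hne' : x₁ * y₁ + x₂ * y₂ - k ≠ 0 := sub_ne_zero.2 hne
  refine hxy ⟨?_, ?_⟩ <;> apply mul_left_cancel₀ hne'
  · linear_combination y₁ * hxp - x₁ * hyp - (2 * p₂ - x₂ - y₂) * hdet
  · linear_combination y₂ * hxp - x₂ * hyp + (2 * p₁ - x₁ - y₁) * hdet

namespace Circ

lemma mem_points_iff_s9 (D : Circ) (x : EuclideanSpace ℝ (Fin 2)) :
    x ∈ D.points ↔ (x 0 - D.center 0) ^ 2 + (x 1 - D.center 1) ^ 2 = D.radius ^ 2 := by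
  rw [points, Metric.mem_sphere, ← sq_eq_sq₀ dist_nonneg D.radius_pos.le,
    EuclideanSpace.dist_sq_eq, Fin.sum_univ_two, Real.dist_eq, Real.dist_eq, sq_abs, sq_abs]

lemma mem_openDisk_iff (D : Circ) (x : EuclideanSpace ℝ (Fin 2)) :
    x ∈ D.openDisk ↔ (x 0 - D.center 0) ^ 2 + (x 1 - D.center 1) ^ 2 < D.radius ^ 2 := by
  rw [openDisk, Metric.mem_ball, ← sq_lt_sq₀ dist_nonneg D.radius_pos.le,
    EuclideanSpace.dist_sq_eq, Fin.sum_univ_two, Real.dist_eq, Real.dist_eq, sq_abs, sq_abs]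

lemma Orthogonal.coord {D E : Circ} (h : Orthogonal D E) :
    (D.center 0 - E.center 0) ^ 2 + (D.center 1 - E.center 1) ^ 2 =
      D.radius ^ 2 + E.radius ^ 2 := by
  rw [← h.2, EuclideanSpace.dist_sq_eq, Fin.sum_univ_two, Real.dist_eq, Real.dist_eq, sq_abs,
    sq_abs]

/-- Circles orthogonal to a common circle are determined by their centers. -/
lemma eq_of_center_eq {C D E : Circ} (hD : Orthogonal D C) (hE : Orthogonal E C)
    (h : D.center 0 - C.center 0 = E.center 0 - C.center 0 ∧
      D.center 1 - C.center 1 = E.center 1 - C.center 1) : D = E := by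
  have hc : D.center = E.center := by
    ext i
    fin_cases i
    · simpa using h.1
    · simpa using h.2
  have hr : D.radius ^ 2 = E.radius ^ 2 := by
    have h₁ := hD.2
    have h₂ := hE.2
    rw [hc] at h₁
    linarith
  rw [sq_eq_sq₀ D.radius_pos.le E.radius_pos.le] at hr
  cases D
  cases E
  simp_all

lemma Orthogonal.inner_centers {C D E : Circ} (hD : Orthogonal D C) (hE : Orthogonal E C)
    (h : Orthogonal D E) :
    (D.center 0 - C.center 0) * (E.center 0 - C.center 0) +
      (D.center 1 - C.center 1) * (E.center 1 - C.center 1) = C.radius ^ 2 := by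
  linear_combination (hD.coord + hE.coord - h.coord) / 2

lemma Orthogonal.radius_sq_lt {C D : Circ} (hD : Orthogonal D C) :
    C.radius ^ 2 < (D.center 0 - C.center 0) ^ 2 + (D.center 1 - C.center 1) ^ 2 := by
  have := pow_pos D.radius_pos 2
  linarith [hD.coord]

/-- The common points of two circles orthogonal to `C` are collinear with the center of `C`. -/
lemma cross_points {C D E : Circ} (hD : Orthogonal D C) (hE : Orthogonal E C) (hne : D ≠ E)
    {x y : EuclideanSpace ℝ (Fin 2)} (hxD : x ∈ D.points) (hxE : x ∈ E.points)
    (hyD : y ∈ D.points) (hyE : y ∈ E.points) :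
    (x 0 - C.center 0) * (y 1 - C.center 1) - (x 1 - C.center 1) * (y 0 - C.center 0) = 0 := by
  rw [mem_points_iff_s9] at hxD hxE hyD hyE
  have hDc := hD.coord
  have hEc := hE.coord
  exact cross_eq_zero_of_mem_inter (k := C.radius ^ 2)
    (fun h => hne (eq_of_center_eq hD hE h))
    (by linear_combination hxD - hDc) (by linear_combination hxE - hEc)
    (by linear_combination hyD - hDc) (by linear_combination hyE - hEc)

/-- Two distinct common points of two circles orthogonal to `C` have inner product
`C.radius ^ 2` with respect to the center of `C`. -/
lemma inner_points {C D E : Circ} (hD : Orthogonal D C) (hE : Orthogonal E C) (hne : D ≠ E)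
    {x y : EuclideanSpace ℝ (Fin 2)} (hxy : x ≠ y) (hxD : x ∈ D.points) (hxE : x ∈ E.points)
    (hyD : y ∈ D.points) (hyE : y ∈ E.points) :
    (x 0 - C.center 0) * (y 0 - C.center 0) + (x 1 - C.center 1) * (y 1 - C.center 1) =
      C.radius ^ 2 := by
  have hcross := cross_points hD hE hne hxD hxE hyD hyE
  rw [mem_points_iff_s9] at hxD hyD
  have hDc := hD.coord
  refine inner_eq_of_cross_eq_zero (p₁ := D.center 0 - C.center 0)
    (p₂ := D.center 1 - C.center 1) (fun h => hxy ?_) hcross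
    (by linear_combination hxD - hDc) (by linear_combination hyD - hDc)
  ext i
  fin_cases i
  · simpa using h.1
  · simpa using h.2

/-- Two distinct circles orthogonal to `C` share at most one point inside `C`. -/
lemma eq_of_mem_openDisk {C D E : Circ} (hD : Orthogonal D C) (hE : Orthogonal E C) (hne : D ≠ E)
    {x y : EuclideanSpace ℝ (Fin 2)} (hxD : x ∈ D.points) (hxE : x ∈ E.points)
    (hyD : y ∈ D.points) (hyE : y ∈ E.points) (hx : x ∈ C.openDisk) (hy : y ∈ C.openDisk) :
    x = y := by
  by_contra hxy
  have h := inner_points hD hE hne hxy hxD hxE hyD hyE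
  rw [mem_openDisk_iff] at hx hy
  nlinarith [sq_nonneg (x 0 - y 0), sq_nonneg (x 1 - y 1)]

/-- Two distinct circles orthogonal to `C` share at most two points. -/
lemma encard_inter_le_two {C D E : Circ} (hD : Orthogonal D C) (hE : Orthogonal E C)
    (hne : D ≠ E) : (D.points ∩ E.points).encard ≤ 2 := by
  by_contra! h
  obtain ⟨t, ht, htc⟩ := Set.exists_subset_encard_eq (Order.add_one_le_of_lt h)
  obtain ⟨x, y, z, hxy, hxz, hyz, rfl⟩ := Set.encard_eq_three.1 (htc.trans (by norm_num))
  have hx := ht (show x ∈ _ by simp)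
  have hy := ht (show y ∈ _ by simp)
  have hz := ht (show z ∈ _ by simp)
  have h₁ := inner_points hD hE hne hxy hx.1 hx.2 hy.1 hy.2
  have h₂ := inner_points hD hE hne hxz hx.1 hx.2 hz.1 hz.2
  have h₃ := cross_points hD hE hne hy.1 hy.2 hz.1 hz.2
  refine hyz ?_
  ext i
  apply mul_left_cancel₀ (pow_pos C.radius_pos 2).ne'
  fin_cases i
  · change C.radius ^ 2 * y 0 = C.radius ^ 2 * z 0
    linear_combination (x 1 - C.center 1) * h₃ - (y 0 - C.center 0) * h₂ + (z 0 - C.center 0) * h₁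
  · change C.radius ^ 2 * y 1 = C.radius ^ 2 * z 1
    linear_combination -(x 0 - C.center 0) * h₃ - (y 1 - C.center 1) * h₂ + (z 1 - C.center 1) * h₁

end Circ

theorem stmt9 (𝒜 : Finset Circ)
    (ho : (𝒜 : Set Circ).Pairwise fun X Y => Intersects X Y → Orthogonal X Y)
    (C : Circ) (hC : C ∈ 𝒜)
    (I : Finset Circ)
    (hI : I = 𝒜.filter fun D => D ≠ C ∧ Intersects D C ∧ 1 ≤ depth 𝒜 D)
    (h7 : I.card ≤ 7) :
    ({p : EuclideanSpace ℝ (Fin 2) |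
        ∃ D ∈ I, ∃ E ∈ I, D ≠ E ∧ p ∈ D.points ∧ p ∈ E.points}).Finite ∧
    ({p : EuclideanSpace ℝ (Fin 2) |
        ∃ D ∈ I, ∃ E ∈ I, D ≠ E ∧ p ∈ D.points ∧ p ∈ E.points}).ncard ≤ 16 ∧
    ({p : EuclideanSpace ℝ (Fin 2) |
        ∃ D ∈ I, ∃ E ∈ I, D ≠ E ∧ p ∈ D.points ∧ p ∈ E.points} ∩ C.openDisk).ncard ≤ 8 := by
  have hIC : ∀ D ∈ I, Orthogonal D C := fun D hD => by
    rw [hI, Finset.mem_filter] at hD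
    exact ho hD.1 hC hD.2.1 hD.2.2.1
  have hI𝒜 : ∀ D ∈ I, D ∈ 𝒜 := fun D hD => by
    rw [hI, Finset.mem_filter] at hD
    exact hD.1
  let G : SimpleGraph I :=
    { Adj := fun D E => D ≠ E ∧ Orthogonal D.1 E.1
      symm := ⟨fun D E h => ⟨h.1.symm, by
        rw [Orthogonal, Intersects, Set.inter_comm, dist_comm, add_comm]
        exact h.2⟩⟩
      loopless := ⟨fun D h => h.1 rfl⟩ }
  have hinner (D E : I) (h : G.Adj D E) := (hIC D D.2).inner_centers (hIC E E.2) h.2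
  have hk : 0 < C.radius ^ 2 := pow_pos C.radius_pos 2
  have hcard : G.edgeFinset.card ≤ 8 := by
    refine card_edgeFinset_le_eight G (fun u v w huv hvw huw => ?_)
      (fun u v w x huv huw hvw hux hvx => ?_) (by simpa using h7)
    · exact not_pairwise_inner_eq hk (hIC u u.2).radius_sq_lt (hIC v v.2).radius_sq_lt
        (hIC w w.2).radius_sq_lt (hinner u v huv) (hinner v w hvw) (hinner u w huw)
    · exact Subtype.ext <| eq_of_center_eq (hIC w w.2) (hIC x x.2) <|
        eq_of_inner_eq hk.ne' (hinner u w huw) (hinner v w hvw) (hinner u x hux) (hinner v x hvx)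
          fun h => huv <| Subtype.ext <| eq_of_center_eq (hIC u u.2) (hIC v v.2) h
  let P : Sym2 I → Set (EuclideanSpace ℝ (Fin 2)) := fun e => {p | ∀ D ∈ e, p ∈ D.1.points}
  have hP (D E : I) : P s(D, E) = D.1.points ∩ E.1.points := by
    ext p
    simp only [P, Set.mem_ofPred_eq, Sym2.mem_iff, forall_eq_or_imp, forall_eq, Set.mem_inter_iff]
  have htwo : ∀ e ∈ G.edgeFinset, (P e).encard ≤ 2 := by
    intro e
    induction e with | _ D E
    intro he
    rw [hP]
    rw [SimpleGraph.mem_edgeFinset, SimpleGraph.mem_edgeSet] at he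
    exact encard_inter_le_two (hIC D D.2) (hIC E E.2) fun h => he.1 (Subtype.ext h)
  have hone : ∀ e ∈ G.edgeFinset, (P e ∩ C.openDisk).encard ≤ 1 := by
    intro e
    induction e with | _ D E
    intro he
    rw [hP]
    rw [SimpleGraph.mem_edgeFinset, SimpleGraph.mem_edgeSet] at he
    rw [Set.encard_le_one_iff]
    rintro x y ⟨hx, hxC⟩ ⟨hy, hyC⟩
    exact eq_of_mem_openDisk (hIC D D.2) (hIC E E.2) (fun h => he.1 (Subtype.ext h))
      hx.1 hx.2 hy.1 hy.2 hxC hyC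
  have hsub : {p : EuclideanSpace ℝ (Fin 2) |
      ∃ D ∈ I, ∃ E ∈ I, D ≠ E ∧ p ∈ D.points ∧ p ∈ E.points} ⊆ ⋃ e ∈ G.edgeFinset, P e := by
    rintro p ⟨D, hD, E, hE, hne, hpD, hpE⟩
    refine Set.mem_biUnion (x := s(⟨D, hD⟩, ⟨E, hE⟩)) ?_ ?_
    · simp only [SetLike.mem_coe, SimpleGraph.mem_edgeFinset, SimpleGraph.mem_edgeSet]
      exact ⟨fun h => hne (congrArg Subtype.val h),
        ho (hI𝒜 D hD) (hI𝒜 E hE) hne ⟨p, hpD, hpE⟩⟩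
    · rw [hP]
      exact ⟨hpD, hpE⟩
  have hfin : (⋃ e ∈ G.edgeFinset, P e).Finite :=
    G.edgeFinset.finite_toSet.biUnion fun e he =>
      Set.finite_of_encard_le_coe (k := 2) (htwo e he)
  have bound (Q : Sym2 I → Set (EuclideanSpace ℝ (Fin 2))) (m : ℕ)
      (hQ : ∀ e ∈ G.edgeFinset, (Q e).encard ≤ m) :
      (⋃ e ∈ G.edgeFinset, Q e).ncard ≤ 8 * m :=
    (Finset.set_ncard_biUnion_le _ _).trans <|
      (Finset.sum_le_card_nsmul _ _ m fun e he =>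
        (Set.encard_le_coe_iff_finite_ncard_le.1 (hQ e he)).2).trans
          (Nat.mul_le_mul_right m hcard)
  refine ⟨hfin.subset hsub, (Set.ncard_le_ncard hsub hfin).trans (bound P 2 htwo), ?_⟩
  have hsub' := Set.inter_subset_inter_left C.openDisk hsub
  have hfin' := hfin.inter_of_left C.openDisk
  rw [Set.iUnion₂_inter] at hsub' hfin'
  exact (Set.ncard_le_ncard hsub' hfin').trans (bound (fun e => P e ∩ C.openDisk) 1 hone)
end
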